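/- arXiv:1310.0910 — 12 statements merged into one kernel-verified Lean document; each statement's English description precedes it below -/
import Mathlib

section
/- Let n ≥ 3 be an odd integer and let v_1, …, v_n be vectors in E with ‖v_i‖ = 1 for every i. If there is a nonzero linear functional u : E → ℝ such that u(v_i) ≥ 0 for every i ∈ {1,…,n}, then ‖v_1 + v_2 + ⋯ + v_n‖ ≥ 1. -/
open scoped NNReal

/-- Adding two unit vectors to a vector of the cone they span does not decrease the norm. -/
theorem norm_le_norm_add_of_mem_span_pair {E : Type*} [NormedAddCommGroup E] [NormedSpace ℝ E]
    {x y w : E} (hx : ‖x‖ = 1) (hy : ‖y‖ = 1) (hw : w ∈ Submodule.span ℝ≥0 {x, y}) :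
    ‖w‖ ≤ ‖w + (x + y)‖ := by
  obtain ⟨a, b, rfl⟩ := Submodule.mem_span_pair.1 hw
  wlog hab : b ≤ a generalizing x y a b
  · have := this hy hx b a (Submodule.mem_span_pair.2 ⟨b, a, rfl⟩) (le_of_not_ge hab)
    rwa [add_comm (b • y), add_comm y x] at this
  have hab' : (b : ℝ) ≤ a := hab
  have hb : (0 : ℝ) ≤ b := b.2
  simp only [NNReal.smul_def]
  set s := (a : ℝ) • x + (b : ℝ) • y + (x + y) with hs
  have lower : (a : ℝ) - b ≤ ‖s‖ := by
    have h : ((a : ℝ) + 1) • x = s - ((b : ℝ) + 1) • y := by rw [hs]; module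
    have h' := norm_sub_le s (((b : ℝ) + 1) • y)
    rw [← h, norm_smul, norm_smul, hx, hy, Real.norm_of_nonneg (by linarith),
      Real.norm_of_nonneg (by linarith)] at h'
    linarith
  have convex : (1 + (b : ℝ)) * ‖(a : ℝ) • x + (b : ℝ) • y‖ ≤ b * ‖s‖ + (a - b) := by
    have h : (1 + (b : ℝ)) • ((a : ℝ) • x + (b : ℝ) • y) = (b : ℝ) • s + ((a : ℝ) - b) • x := by
      rw [hs]; module
    have h' := norm_add_le ((b : ℝ) • s) (((a : ℝ) - b) • x)
    rwa [← h, norm_smul, norm_smul, norm_smul, hx, Real.norm_of_nonneg (by linarith),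
      Real.norm_of_nonneg hb, Real.norm_of_nonneg (by linarith), mul_one] at h'
  exact le_of_mul_le_mul_left (by linarith) (by linarith : (0 : ℝ) < 1 + b)

theorem exists_relation_of_finrank_eq_two {E : Type*} [AddCommGroup E] [Module ℝ E]
    (hdim : Module.finrank ℝ E = 2) (x y z : E) :
    ∃ a b c : ℝ, a • x + b • y + c • z = 0 ∧ (a ≠ 0 ∨ b ≠ 0 ∨ c ≠ 0) := by
  have : Module.Finite ℝ E := Module.finite_of_finrank_pos (by omega)
  have h : ¬ LinearIndependent ℝ ![x, y, z] := fun h => by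
    have := h.fintype_card_le_finrank
    simp [hdim] at this
  obtain ⟨g, hg, i, hi⟩ := Fintype.not_linearIndependent_iff.1 h
  refine ⟨g 0, g 1, g 2, by simpa [Fin.sum_univ_three] using hg, ?_⟩
  fin_cases i <;> simp_all

/-- Two unit vectors on the same line through the origin are equal or opposite. -/
theorem eq_or_add_eq_zero_of_map_eq_zero {E : Type*} [NormedAddCommGroup E] [NormedSpace ℝ E]
    (hdim : Module.finrank ℝ E = 2) {u : E →ₗ[ℝ] ℝ} (hu : u ≠ 0) {x y : E}
    (hx : ‖x‖ = 1) (hy : ‖y‖ = 1) (hux : u x = 0) (huy : u y = 0) : x = y ∨ x + y = 0 := by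
  obtain ⟨r, hr⟩ : ∃ r, u r ≠ 0 := by
    by_contra! h
    exact hu (LinearMap.ext h)
  obtain ⟨a, b, c, h, hne⟩ := exists_relation_of_finrank_eq_two hdim x y r
  have hc : c = 0 := by
    have := congrArg u h
    simpa [hux, huy, hr] using this
  subst hc
  rw [zero_smul, add_zero] at h
  have hxy : a • x = -(b • y) := eq_neg_of_add_eq_zero_left h
  have habs : |a| = |b| := by
    simpa [norm_smul, hx, hy] using congrArg norm hxy
  have ha : a ≠ 0 := by
    rintro rfl
    have : b = 0 := by simpa using habs.symm
    simp [this] at hne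
  rcases abs_eq_abs.1 habs with rfl | rfl
  · exact .inr ((smul_eq_zero.1 ((smul_add a x y).trans h)).resolve_left ha)
  · left
    rw [neg_smul, neg_inj] at hxy
    exact smul_right_injective E (neg_ne_zero.1 ha) hxy

theorem mem_span_pair_of_relation {E : Type*} [AddCommGroup E] [Module ℝ E]
    {x y z : E} {a b c : ℝ} (ha : 0 < a) (hb : b ≤ 0) (hc : c ≤ 0)
    (h : a • x + b • y + c • z = 0) : x ∈ Submodule.span ℝ≥0 {y, z} := by
  refine Submodule.mem_span_pair.2 ⟨(-b / a).toNNReal, (-c / a).toNNReal, ?_⟩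
  rw [NNReal.smul_def, NNReal.smul_def, Real.coe_toNNReal _ (div_nonneg (by linarith) ha.le),
    Real.coe_toNNReal _ (div_nonneg (by linarith) ha.le)]
  refine smul_right_injective E ha.ne' ?_
  simp only [smul_add, smul_smul, mul_div_cancel₀ _ ha.ne']
  linear_combination (norm := module) (-1 : ℝ) • h

/-- One of `x`, `y`, `z` lies in the cone spanned by the other two, or two of them are opposite. -/
def ConeDependent {E : Type*} [AddCommGroup E] [Module ℝ E] (x y z : E) : Prop :=
  x ∈ Submodule.span ℝ≥0 {y, z} ∨ y ∈ Submodule.span ℝ≥0 {x, z} ∨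
    z ∈ Submodule.span ℝ≥0 {x, y} ∨ x + y = 0 ∨ x + z = 0 ∨ y + z = 0

namespace ConeDependent

theorem swap {E : Type*} [AddCommGroup E] [Module ℝ E] {x y z : E}
    (h : ConeDependent x y z) : ConeDependent y x z := by
  unfold ConeDependent at *
  rw [Set.pair_comm y x, add_comm y x]
  tauto

theorem rotate {E : Type*} [AddCommGroup E] [Module ℝ E] {x y z : E}
    (h : ConeDependent x y z) : ConeDependent y z x := by
  unfold ConeDependent at *
  rw [Set.pair_comm z x, Set.pair_comm y x, add_comm y x, add_comm z x]
  tauto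

end ConeDependent

theorem coneDependent_of_relation {E : Type*} [NormedAddCommGroup E] [NormedSpace ℝ E]
    (hdim : Module.finrank ℝ E = 2) {u : E →ₗ[ℝ] ℝ} (hu : u ≠ 0) {x y z : E}
    (hx : ‖x‖ = 1) (hy : ‖y‖ = 1) (hz : ‖z‖ = 1)
    (hux : 0 ≤ u x) (huy : 0 ≤ u y) (huz : 0 ≤ u z) {a b c : ℝ} (ha : 0 < a)
    (h : a • x + b • y + c • z = 0) : ConeDependent x y z := by
  wlog hbc : c ≤ b generalizing y z b c
  · have := this hz hy huz huy (b := c) (c := b) (by rw [← h]; abel) (le_of_not_ge hbc)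
    exact this.rotate.swap.rotate.rotate
  rcases le_or_gt b 0 with hb | hb
  · exact .inl (mem_span_pair_of_relation ha hb (hbc.trans hb) h)
  rcases lt_or_ge c 0 with hc | hc
  · refine .inr (.inr (.inl (mem_span_pair_of_relation (a := -c) (b := -a) (c := -b)
      (by linarith) (by linarith) (by linarith) ?_)))
    linear_combination (norm := module) (-1 : ℝ) • h
  have hsum : a * u x + b * u y + c * u z = 0 := by simpa using congrArg u h
  have h₁ := mul_nonneg ha.le hux
  have h₂ := mul_nonneg hb.le huy
  have h₃ := mul_nonneg hc huz
  have hux' : u x = 0 := (mul_eq_zero.1 (by linarith : a * u x = 0)).resolve_left ha.ne'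
  have huy' : u y = 0 := (mul_eq_zero.1 (by linarith : b * u y = 0)).resolve_left hb.ne'
  rcases eq_or_add_eq_zero_of_map_eq_zero hdim hu hx hy hux' huy' with rfl | hxy
  · exact .inl (Submodule.subset_span (by simp))
  · exact .inr (.inr (.inr (.inl hxy)))

theorem coneDependent_of_halfplane {E : Type*} [NormedAddCommGroup E] [NormedSpace ℝ E]
    (hdim : Module.finrank ℝ E = 2) {u : E →ₗ[ℝ] ℝ} (hu : u ≠ 0) {x y z : E}
    (hx : ‖x‖ = 1) (hy : ‖y‖ = 1) (hz : ‖z‖ = 1)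
    (hux : 0 ≤ u x) (huy : 0 ≤ u y) (huz : 0 ≤ u z) : ConeDependent x y z := by
  have key : ∀ {x y z : E}, ‖x‖ = 1 → ‖y‖ = 1 → ‖z‖ = 1 → 0 ≤ u x → 0 ≤ u y → 0 ≤ u z →
      ∀ {a b c : ℝ}, a ≠ 0 → a • x + b • y + c • z = 0 → ConeDependent x y z := by
    intro x y z hx hy hz hux huy huz a b c ha h
    rcases ha.lt_or_gt with ha | ha
    · refine coneDependent_of_relation hdim hu hx hy hz hux huy huz (a := -a) (b := -b) (c := -c)
        (by linarith) ?_
      linear_combination (norm := module) (-1 : ℝ) • h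
    · exact coneDependent_of_relation hdim hu hx hy hz hux huy huz ha h
  obtain ⟨a, b, c, h, ha | hb | hc⟩ := exists_relation_of_finrank_eq_two hdim x y z
  · exact key hx hy hz hux huy huz ha h
  · exact (key hy hz hx huy huz hux (b := c) (c := a) hb (by rw [← h]; abel)).rotate.rotate
  · exact (key hz hx hy huz hux huy (b := a) (c := b) hc (by rw [← h]; abel)).rotate

/-- Unit vectors in a half-plane either contain two opposite ones or lie in the cone spanned by
two of them. -/
theorem exists_extreme_pair {E ι : Type*} [NormedAddCommGroup E] [NormedSpace ℝ E]
    (hdim : Module.finrank ℝ E = 2) {u : E →ₗ[ℝ] ℝ} (hu : u ≠ 0) {v : ι → E}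
    (hv : ∀ i, ‖v i‖ = 1) (hpos : ∀ i, 0 ≤ u (v i)) {s : Finset ι} (hs : s.Nonempty) :
    ∃ i ∈ s, ∃ j ∈ s, v i + v j = 0 ∨ ∀ k ∈ s, v k ∈ Submodule.span ℝ≥0 {v i, v j} := by
  classical
  induction hs using Finset.Nonempty.cons_induction with
  | singleton a =>
    refine ⟨a, by simp, a, by simp, .inr fun k hk => Submodule.subset_span ?_⟩
    simp [Finset.mem_singleton.1 hk]
  | cons a s ha hs ih =>
    obtain ⟨i, hi, j, hj, hij | hij⟩ := ih
    · exact ⟨i, by simp [hi], j, by simp [hj], .inl hij⟩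
    have extend : ∀ p q : ι, v i ∈ Submodule.span ℝ≥0 {v p, v q} →
        v j ∈ Submodule.span ℝ≥0 {v p, v q} → v a ∈ Submodule.span ℝ≥0 {v p, v q} →
        ∀ k ∈ Finset.cons a s ha, v k ∈ Submodule.span ℝ≥0 {v p, v q} := by
      intro p q hip hjp hap k hk
      rcases Finset.mem_cons.1 hk with rfl | hk
      · exact hap
      · exact Submodule.span_le.2 (Set.insert_subset hip (Set.singleton_subset_iff.2 hjp))
          (hij k hk)
    have left : ∀ p q : ι, v p ∈ Submodule.span ℝ≥0 {v p, v q} := fun p q =>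
      Submodule.subset_span (by simp)
    have right : ∀ p q : ι, v q ∈ Submodule.span ℝ≥0 {v p, v q} := fun p q =>
      Submodule.subset_span (by simp)
    rcases coneDependent_of_halfplane hdim hu (hv i) (hv j) (hv a) (hpos i) (hpos j) (hpos a)
      with h | h | h | h | h | h
    · exact ⟨j, by simp [hj], a, by simp, .inr (extend j a h (left _ _) (right _ _))⟩
    · exact ⟨i, by simp [hi], a, by simp, .inr (extend i a (left _ _) h (right _ _))⟩
    · exact ⟨i, by simp [hi], j, by simp [hj], .inr (extend i j (left _ _) (right _ _) h)⟩
    · exact ⟨i, by simp [hi], j, by simp [hj], .inl h⟩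
    · exact ⟨i, by simp [hi], a, by simp, .inl h⟩
    · exact ⟨j, by simp [hj], a, by simp, .inl h⟩

/-- Among at least two unit vectors in a half-plane, two can be removed without increasing the
norm of the sum. -/
theorem exists_norm_sum_erase_erase_le {E ι : Type*} [DecidableEq ι] [NormedAddCommGroup E]
    [NormedSpace ℝ E] (hdim : Module.finrank ℝ E = 2) {u : E →ₗ[ℝ] ℝ} (hu : u ≠ 0) {v : ι → E}
    (hv : ∀ i, ‖v i‖ = 1) (hpos : ∀ i, 0 ≤ u (v i)) {s : Finset ι} (hs : 1 < s.card) :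
    ∃ i ∈ s, ∃ j ∈ s.erase i, ‖∑ k ∈ (s.erase i).erase j, v k‖ ≤ ‖∑ k ∈ s, v k‖ := by
  have split : ∀ i ∈ s, ∀ j ∈ s.erase i,
      ∑ k ∈ s, v k = ∑ k ∈ (s.erase i).erase j, v k + (v i + v j) := by
    intro i hi j hj
    rw [← Finset.add_sum_erase s v hi, ← Finset.add_sum_erase _ v hj]
    abel
  have of_cone : ∀ i ∈ s, ∀ j ∈ s.erase i,
      (∀ k ∈ s, v k ∈ Submodule.span ℝ≥0 {v i, v j}) →
      ‖∑ k ∈ (s.erase i).erase j, v k‖ ≤ ‖∑ k ∈ s, v k‖ := by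
    intro i hi j hj h
    rw [split i hi j hj]
    exact norm_le_norm_add_of_mem_span_pair (hv i) (hv j) (Submodule.sum_mem _ fun k hk =>
      h k (Finset.mem_of_mem_erase (Finset.mem_of_mem_erase hk)))
  obtain ⟨i, hi, j, hj, h⟩ :=
    exists_extreme_pair hdim hu hv hpos (Finset.card_pos.1 (by omega : 0 < s.card))
  rcases eq_or_ne j i with rfl | hne
  · obtain ⟨l, hl, hlj⟩ := Finset.exists_mem_ne hs j
    have hl' := Finset.mem_erase.2 ⟨hlj, hl⟩
    refine ⟨j, hj, l, hl', of_cone j hj l hl' ?_⟩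
    rcases h with h | h
    · have hzero : v j = 0 := by
        rw [← two_smul ℝ] at h
        exact (smul_eq_zero.1 h).resolve_left two_ne_zero
      have := hv j
      simp [hzero] at this
    · exact fun k hk => Submodule.span_mono (by simp) (h k hk)
  · have hj' := Finset.mem_erase.2 ⟨hne, hj⟩
    refine ⟨i, hi, j, hj', ?_⟩
    rcases h with h | h
    · rw [split i hi j hj', h, add_zero]
    · exact of_cone i hi j hj' h

theorem one_le_norm_sum_of_card_eq {E ι : Type*} [NormedAddCommGroup E]
    [NormedSpace ℝ E] (hdim : Module.finrank ℝ E = 2) {u : E →ₗ[ℝ] ℝ} (hu : u ≠ 0) {v : ι → E}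
    (hv : ∀ i, ‖v i‖ = 1) (hpos : ∀ i, 0 ≤ u (v i)) (m : ℕ) (s : Finset ι)
    (hs : s.card = 2 * m + 1) : 1 ≤ ‖∑ i ∈ s, v i‖ := by
  classical
  induction m generalizing s with
  | zero =>
    obtain ⟨i, rfl⟩ := Finset.card_eq_one.1 hs
    simp [hv]
  | succ m ih =>
    obtain ⟨i, hi, j, hj, h⟩ := exists_norm_sum_erase_erase_le hdim hu hv hpos
      (by omega : 1 < s.card)
    refine (ih _ ?_).trans h
    rw [Finset.card_erase_of_mem hj, Finset.card_erase_of_mem hi]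
    omega

/-- Theorem 1 (halfplane theorem): if `n ≥ 3` is odd, the `v i` are unit vectors in a
normed plane `E`, and some nonzero linear functional is nonnegative on all of them,
then their sum has norm at least 1. -/
theorem sum_norm_ge_one_of_halfplane
    {E : Type*} [NormedAddCommGroup E] [NormedSpace ℝ E]
    (hdim : Module.finrank ℝ E = 2)
    {n : ℕ} (hn : 3 ≤ n) (hodd : Odd n)
    (v : Fin n → E) (hv : ∀ i, ‖v i‖ = 1)
    (u : E →ₗ[ℝ] ℝ) (hu : u ≠ 0) (hpos : ∀ i, 0 ≤ u (v i)) :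
    1 ≤ ‖∑ i, v i‖ := by
  obtain ⟨m, hm⟩ := hodd
  exact one_le_norm_sum_of_card_eq hdim hu hv hpos m Finset.univ (by simpa using hm)
end

section
/- Let n ≥ 3 be an odd integer and let v_1, …, v_n be vectors in E with ‖v_i‖ = 1 for every i. If for all pairwise distinct indices i, j, k one has ‖v_i + v_j + v_k‖ ≥ 1, then ‖v_1 + v_2 + ⋯ + v_n‖ ≥ 1. -/
section NormedPlane

variable {E : Type*} [NormedAddCommGroup E] [NormedSpace ℝ E]

/-- A nonzero functional on a plane is the first of two functionals that separate points. -/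
lemma exists_complementary_functional (hdim : Module.finrank ℝ E = 2) (f : E →ₗ[ℝ] ℝ)
    (hf : f ≠ 0) : ∃ k : E →ₗ[ℝ] ℝ, ∀ x, f x = 0 → k x = 0 → x = 0 := by
  have : Module.Finite ℝ E := Module.finite_of_finrank_eq_succ hdim
  let b := Module.finBasisOfFinrankEq ℝ E hdim
  have hfx (x : E) : f x = b.repr x 0 * f (b 0) + b.repr x 1 * f (b 1) := by
    conv_lhs => rw [← b.sum_repr x, Fin.sum_univ_two]
    simp only [map_add, map_smul, smul_eq_mul]
  refine ⟨f (b 0) • b.coord 1 - f (b 1) • b.coord 0, fun x h0 h1 => ?_⟩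
  rw [hfx] at h0
  simp only [LinearMap.sub_apply, LinearMap.smul_apply, Module.Basis.coord_apply,
    smul_eq_mul] at h1
  have hne : f (b 0) ^ 2 + f (b 1) ^ 2 ≠ 0 := by
    intro h
    apply hf
    ext x
    have e0 : f (b 0) = 0 := by nlinarith [sq_nonneg (f (b 0)), sq_nonneg (f (b 1))]
    have e1 : f (b 1) = 0 := by nlinarith [sq_nonneg (f (b 0)), sq_nonneg (f (b 1))]
    rw [hfx, e0, e1]
    simp
  have e0 : b.repr x 0 = 0 := by
    refine (mul_eq_zero.mp (?_ : (f (b 0) ^ 2 + f (b 1) ^ 2) * b.repr x 0 = 0)).resolve_left hne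
    linear_combination f (b 0) * h0 - f (b 1) * h1
  have e1 : b.repr x 1 = 0 := by
    refine (mul_eq_zero.mp (?_ : (f (b 0) ^ 2 + f (b 1) ^ 2) * b.repr x 1 = 0)).resolve_left hne
    linear_combination f (b 1) * h0 + f (b 0) * h1
  rw [← b.sum_repr x, Fin.sum_univ_two, e0, e1]
  simp

/-- Adding two unit vectors to a vector of the cone they span does not decrease its norm. -/
lemma norm_le_norm_add_add_of_mem_cone {p q : E} (hp : ‖p‖ = 1) (hq : ‖q‖ = 1) {a b : ℝ}
    (ha : 0 ≤ a) (hb : 0 ≤ b) : ‖a • p + b • q‖ ≤ ‖a • p + b • q + (p + q)‖ := by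
  wlog hab : b ≤ a generalizing p q a b
  · have := this hq hp hb ha (le_of_not_ge hab)
    rwa [add_comm (b • q), add_comm q] at this
  rcases ha.eq_or_lt with rfl | ha
  · simp [le_antisymm hab hb]
  set u := a • p + b • q with hu
  have h1 : a - b ≤ ‖u‖ := by
    have h := norm_sub_le u (b • q)
    rw [hu, add_sub_cancel_right, ← hu, norm_smul, norm_smul, hp, hq, Real.norm_of_nonneg ha.le,
      Real.norm_of_nonneg hb] at h
    linarith
  have h2 : (a + 1) * ‖u‖ ≤ (a - b) + a * ‖u + (p + q)‖ := by
    have e : (a + 1) • u = (-(a - b)) • q + a • (u + (p + q)) := by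
      rw [hu]; module
    have h := norm_add_le ((-(a - b)) • q) (a • (u + (p + q)))
    rw [← e, norm_smul, norm_smul, norm_smul, norm_neg, hq, Real.norm_of_nonneg ha.le,
      Real.norm_of_nonneg (by linarith : (0 : ℝ) ≤ a - b),
      Real.norm_of_nonneg (by linarith : (0 : ℝ) ≤ a + 1)] at h
    linarith
  exact le_of_mul_le_mul_left (by linarith) ha

/-- A vanishing positive combination of three unit vectors whose sum has norm at least one
has its largest coefficient equal to the sum of the other two. -/
lemma coeff_eq_add_of_le {a b c : E} (ha : ‖a‖ = 1) (hb : ‖b‖ = 1) (hc : ‖c‖ = 1)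
    {α β γ : ℝ} (hα : 0 < α) (hβ : 0 < β) (hαγ : α ≤ γ) (hβγ : β ≤ γ)
    (h0 : α • a + β • b + γ • c = 0) (h : 1 ≤ ‖a + b + c‖) : γ = α + β := by
  have hγ : 0 < γ := hα.trans_le hαγ
  apply le_antisymm
  · have e : γ • c = -(α • a + β • b) := eq_neg_of_add_eq_zero_right h0
    have h' := norm_add_le (α • a) (β • b)
    rw [← norm_neg, ← e, norm_smul, norm_smul, norm_smul, ha, hb, hc, Real.norm_of_nonneg hα.le,
      Real.norm_of_nonneg hβ.le, Real.norm_of_nonneg hγ.le] at h'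
    linarith
  · have e : γ • (a + b + c) = (γ - α) • a + (γ - β) • b := by
      rw [← sub_zero (γ • (a + b + c)), ← h0]; module
    have h' := norm_add_le ((γ - α) • a) ((γ - β) • b)
    rw [← e, norm_smul, norm_smul, norm_smul, ha, hb, Real.norm_of_nonneg hγ.le,
      Real.norm_of_nonneg (sub_nonneg.2 hαγ), Real.norm_of_nonneg (sub_nonneg.2 hβγ)] at h'
    nlinarith

lemma coeff_eq_add {a b c : E} (ha : ‖a‖ = 1) (hb : ‖b‖ = 1) (hc : ‖c‖ = 1)
    {α β γ : ℝ} (hα : 0 < α) (hβ : 0 < β) (hγ : 0 < γ)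
    (h0 : α • a + β • b + γ • c = 0) (h : 1 ≤ ‖a + b + c‖) :
    α = β + γ ∨ β = α + γ ∨ γ = α + β := by
  by_cases h1 : α ≤ γ ∧ β ≤ γ
  · exact .inr (.inr (coeff_eq_add_of_le ha hb hc hα hβ h1.1 h1.2 h0 h))
  by_cases h2 : α ≤ β
  · refine .inr (.inl (coeff_eq_add_of_le ha hc hb hα hγ h2 ?_ (by rw [← h0]; abel)
      (by rwa [add_right_comm])))
    by_contra! h3
    exact h1 ⟨h2.trans h3.le, h3.le⟩
  · push Not at h2
    refine .inl (coeff_eq_add_of_le hb hc ha hβ hγ h2.le ?_ (by rw [← h0]; abel)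
      (by rwa [add_comm, ← add_assoc]))
    by_contra! h3
    exact h1 ⟨h3.le, (h2.trans h3).le⟩

lemma abs_apply_le_one {f : E →L[ℝ] ℝ} (hf : ‖f‖ = 1) {x : E} (hx : ‖x‖ = 1) : |f x| ≤ 1 := by
  simpa [hf, hx] using f.le_opNorm x

/-- If `-c` lies on the segment between `a` and `b`, a functional norming `-c` is `1` at `a`
and `b`. -/
lemma exists_norming_functional {a b c : E} (ha : ‖a‖ = 1) (hb : ‖b‖ = 1) (hc : ‖c‖ = 1)
    {α β : ℝ} (hα : 0 < α) (hβ : 0 < β) (h0 : α • a + β • b + (α + β) • c = 0) :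
    ∃ f : E →L[ℝ] ℝ, ‖f‖ = 1 ∧ f a = 1 ∧ f b = 1 ∧ f c = -1 := by
  obtain ⟨g, hg, hgc⟩ := exists_dual_vector ℝ c (by intro h; simp [h] at hc)
  rw [hc] at hgc
  have hgc : g c = 1 := by simpa using hgc
  have h1 := congrArg g h0
  simp only [map_add, map_smul, smul_eq_mul, hgc, map_zero] at h1
  have ha' := (abs_le.1 (abs_apply_le_one hg ha)).1
  have hb' := (abs_le.1 (abs_apply_le_one hg hb)).1
  refine ⟨-g, by simpa using hg, ?_, ?_, by simp [hgc]⟩ <;> simp only [neg_apply] <;> nlinarith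

lemma not_apply_lt_one_of_pos_of_neg {a b c d : E} (ha : ‖a‖ = 1) (hb : ‖b‖ = 1) (hc : ‖c‖ = 1)
    (hd : ‖d‖ = 1) {α β : ℝ} (hα : 0 < α) (hβ : 0 < β)
    (h0 : α • a + β • b + (α + β) • c = 0) (h : 1 ≤ ‖b + c + d‖) {p q : ℝ}
    (hdpq : d = p • a + q • b) (hp : 0 < p) (hq : q < 0) (h1 : p + q ≠ 1) (h2 : p + q ≠ -1) :
    False := by
  have hm : 0 < p * β - q * α := by nlinarith [mul_pos hp hβ]
  have hs : 0 < p * (α + β) := by positivity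
  have h3 : (p * β - q * α) • b + (p * (α + β)) • c + α • d = 0 := by
    rw [← smul_zero p, ← h0, hdpq]; module
  rcases coeff_eq_add hb hc hd hm hs hα h3 h with h4 | h4 | h4
  · exact h2 (mul_left_cancel₀ hα.ne' (by linarith))
  · exact h1 (mul_left_cancel₀ hα.ne' (by linarith))
  · have h3 : (p * β - q * α) • b + (p * (α + β)) • c +
        (p * β - q * α + p * (α + β)) • d = 0 := by rwa [← h4]
    obtain ⟨g, hg, hgb, hgc, -⟩ := exists_norming_functional hb hc hd hm hs h3
    have h5 := congrArg g h0
    simp only [map_add, map_smul, smul_eq_mul, hgb, hgc, map_zero] at h5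
    have ha' := (abs_le.1 (abs_apply_le_one hg ha)).1
    nlinarith

lemma apply_eq_one_or_neg_one (hdim : Module.finrank ℝ E = 2) {a b c d : E} (ha : ‖a‖ = 1)
    (hb : ‖b‖ = 1) (hc : ‖c‖ = 1) (hd : ‖d‖ = 1) (hab : a ≠ b) {α β : ℝ} (hα : 0 < α)
    (hβ : 0 < β) (h0 : α • a + β • b + (α + β) • c = 0) (hac : 1 ≤ ‖a + c + d‖)
    (hbc : 1 ≤ ‖b + c + d‖) {f : E →L[ℝ] ℝ} (hf : ‖f‖ = 1) (hfa : f a = 1) (hfb : f b = 1) :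
    f d = 1 ∨ f d = -1 := by
  by_contra! hfd
  obtain ⟨k, hk⟩ := exists_complementary_functional hdim f.toLinearMap
    (by intro h; have := LinearMap.congr_fun h a; simp [hfa] at this)
  have hkab : k a - k b ≠ 0 := by
    intro h
    exact hab (sub_eq_zero.1 (hk (a - b) (by simp [hfa, hfb]) (by simpa using h)))
  obtain ⟨p, q, hpq, hdpq⟩ : ∃ p q : ℝ, p + q = f d ∧ d = p • a + q • b := by
    refine ⟨(k d - f d * k b) / (k a - k b), f d - (k d - f d * k b) / (k a - k b), by ring,
      sub_eq_zero.1 (hk _ ?_ ?_)⟩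
    · simp [hfa, hfb]
    · simp only [map_sub, map_add, map_smul, smul_eq_mul]
      field_simp
      ring
  rw [← hpq] at hfd
  have hlt : |p + q| ≤ 1 := hpq ▸ abs_apply_le_one hf hd
  have hle : 1 ≤ |p| + |q| := by
    have := norm_add_le (p • a) (q • b)
    rwa [← hdpq, norm_smul, norm_smul, ha, hb, hd, mul_one, mul_one] at this
  rcases lt_trichotomy p 0 with hp | rfl | hp
  · by_cases hq : 0 < q
    · exact not_apply_lt_one_of_pos_of_neg hb ha hc hd hβ hα (by rw [← h0]; module) hac
        (by rw [hdpq, add_comm]) hq hp (by rw [add_comm]; exact hfd.1)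
        (by rw [add_comm]; exact hfd.2)
    · grind
  · grind
  · by_cases hq : q < 0
    · exact not_apply_lt_one_of_pos_of_neg ha hb hc hd hα hβ h0 hbc hdpq hp hq hfd.1 hfd.2
    · grind

/-- An odd number of vectors on which a norm-one functional is `±1` has sum of norm at
least one. -/
lemma one_le_norm_sum_of_apply_eq {ι : Type*} {s : Finset ι} (hs : Odd s.card) {v : ι → E}
    {f : E →L[ℝ] ℝ} (hf : ‖f‖ = 1) (h : ∀ i ∈ s, f (v i) = 1 ∨ f (v i) = -1) :
    1 ≤ ‖∑ i ∈ s, v i‖ := by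
  have h' : ∀ i, ∃ e : ℤ, i ∈ s → f (v i) = 1 - 2 * e := by
    intro i
    by_cases hi : i ∈ s
    · rcases h i hi with h | h
      · exact ⟨0, fun _ => by simp [h]⟩
      · exact ⟨1, fun _ => by norm_num [h]⟩
    · exact ⟨0, fun h => absurd h hi⟩
  choose e he using h'
  obtain ⟨m, hm⟩ := hs
  have hsum : f (∑ i ∈ s, v i) = ((2 * (m - ∑ i ∈ s, e i) + 1 : ℤ) : ℝ) := by
    rw [map_sum, Finset.sum_congr rfl he, Finset.sum_sub_distrib, ← Finset.mul_sum]
    simp [hm]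
    ring
  have h1 : (1 : ℝ) ≤ |f (∑ i ∈ s, v i)| := by
    rw [hsum]
    exact_mod_cast Int.one_le_abs (by omega)
  have h2 := f.le_opNorm (∑ i ∈ s, v i)
  rw [hf, one_mul] at h2
  exact h1.trans h2

/-- The case where the origin lies in the convex hull of the vectors. -/
lemma one_le_norm_sum_of_zero_mem_convexHull (hdim : Module.finrank ℝ E = 2) {ι : Type*}
    {s : Finset ι} (hs : Odd s.card) {v : ι → E} (hv : ∀ i, ‖v i‖ = 1)
    (h3 : ∀ i j k : ι, i ≠ j → i ≠ k → j ≠ k → 1 ≤ ‖v i + v j + v k‖)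
    (hanti : ∀ i ∈ s, ∀ j ∈ s, v i ≠ -v j) (h0 : (0 : E) ∈ convexHull ℝ (v '' s)) :
    1 ≤ ‖∑ i ∈ s, v i‖ := by
  have key {i j k : ι} {α β : ℝ} (hij : v i ≠ v j) (hik : v i ≠ v k) (hjk : v j ≠ v k)
      (hα : 0 < α) (hβ : 0 < β) (h : α • v i + β • v j + (α + β) • v k = 0) :
      1 ≤ ‖∑ i ∈ s, v i‖ := by
    obtain ⟨f, hf, hfi, hfj, hfk⟩ := exists_norming_functional (hv i) (hv j) (hv k) hα hβ h
    refine one_le_norm_sum_of_apply_eq hs hf fun l _ => ?_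
    by_cases hil : i = l
    · exact .inl (hil ▸ hfi)
    by_cases hjl : j = l
    · exact .inl (hjl ▸ hfj)
    by_cases hkl : k = l
    · exact .inr (hkl ▸ hfk)
    exact apply_eq_one_or_neg_one hdim (hv i) (hv j) (hv k) (hv l) hij hα hβ h
      (h3 _ _ _ (ne_of_apply_ne v hik) hil hkl) (h3 _ _ _ (ne_of_apply_ne v hjk) hjl hkl)
      hf hfi hfj
  have : Module.Finite ℝ E := Module.finite_of_finrank_eq_succ hdim
  obtain ⟨κ, _, z, w, hz, hind, hw, hw1, hwz⟩ := eq_pos_convex_span_of_mem_convexHull h0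
  have hcard : Fintype.card κ ≤ 3 := by
    have := hind.card_le_finrank_succ
    have := (vectorSpan ℝ (Set.range z)).finrank_le
    omega
  have hz' (x : κ) : ∃ i ∈ s, v i = z x := hz (Set.mem_range_self x)
  choose t hts ht using hz'
  have hzn (x : κ) : ‖z x‖ = 1 := by rw [← ht, hv]
  obtain ⟨e⟩ : Nonempty (κ ≃ Fin (Fintype.card κ)) := ⟨Fintype.equivFin κ⟩
  rw [← e.symm.sum_comp] at hw1 hwz
  have hinj : Function.Injective z := hind.injective
  generalize Fintype.card κ = m at hcard e hw1 hwz
  interval_cases m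
  · simp at hw1
  · simp only [Finset.univ_unique, Finset.sum_singleton, smul_eq_zero] at hwz
    rcases hwz with h | h
    · exact absurd h (hw _).ne'
    · have := hzn (e.symm default)
      rw [h, norm_zero] at this
      exact absurd this zero_ne_one
  · rw [Fin.sum_univ_two] at hwz
    set x := e.symm 0
    set y := e.symm 1
    have e1 : w x • z x = -(w y • z y) := eq_neg_of_add_eq_zero_left hwz
    have e2 := congrArg norm e1
    rw [norm_neg, norm_smul, norm_smul, hzn, hzn, mul_one, mul_one,
      Real.norm_of_nonneg (hw x).le, Real.norm_of_nonneg (hw y).le] at e2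
    rw [e2, ← smul_neg] at e1
    have e3 := smul_right_injective E (hw y).ne' e1
    exact absurd (by rw [ht, ht, e3]) (hanti _ (hts x) _ (hts y))
  · rw [Fin.sum_univ_three] at hwz
    have hxy : z (e.symm 0) ≠ z (e.symm 1) := hinj.ne (e.symm.injective.ne (by decide))
    have hxr : z (e.symm 0) ≠ z (e.symm 2) := hinj.ne (e.symm.injective.ne (by decide))
    have hyr : z (e.symm 1) ≠ z (e.symm 2) := hinj.ne (e.symm.injective.ne (by decide))
    set x := e.symm 0
    set y := e.symm 1
    set r := e.symm 2
    rw [← ht, ← ht] at hxy hxr hyr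
    rw [← ht, ← ht, ← ht] at hwz
    rcases coeff_eq_add (hv _) (hv _) (hv _) (hw x) (hw y) (hw r) hwz
      (h3 _ _ _ (ne_of_apply_ne v hxy) (ne_of_apply_ne v hxr) (ne_of_apply_ne v hyr))
      with h | h | h <;> rw [h] at hwz
    · exact key hyr hxy.symm hxr.symm (hw y) (hw r) (by rw [← hwz]; abel)
    · exact key hxr hxy hyr.symm (hw x) (hw r) (by rw [← hwz]; abel)
    · exact key hxy hxr hyr (hw x) (hw y) hwz

/-- Finitely many, at least two, vectors in an open half-plane lie in the cone spanned by two
of them. -/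
lemma exists_cone_of_pos (hdim : Module.finrank ℝ E = 2) {ι : Type*} [DecidableEq ι]
    {s : Finset ι} (hs : 1 < s.card) {v : ι → E} (f : E →ₗ[ℝ] ℝ) (hf : ∀ i ∈ s, 0 < f (v i)) :
    ∃ i ∈ s, ∃ j ∈ s.erase i, ∀ l ∈ (s.erase i).erase j,
      ∃ a b : ℝ, 0 ≤ a ∧ 0 ≤ b ∧ v l = a • v i + b • v j := by
  have hne : s.Nonempty := Finset.card_pos.1 (by omega)
  obtain ⟨k, hk⟩ := exists_complementary_functional hdim f (by
    rintro rfl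
    obtain ⟨i, hi⟩ := hne
    simpa using hf i hi)
  obtain ⟨i, hi, hmin⟩ := s.exists_min_image (fun l => k (v l) / f (v l)) hne
  obtain ⟨j, hj, hmax⟩ := (s.erase i).exists_max_image (fun l => k (v l) / f (v l))
    (Finset.card_pos.1 (by rw [Finset.card_erase_of_mem hi]; omega))
  refine ⟨i, hi, j, hj, fun l hl => ?_⟩
  have hl' := Finset.mem_of_mem_erase hl
  have hls := Finset.mem_of_mem_erase hl'
  have hfi := hf i hi
  have hfj := hf j (Finset.mem_of_mem_erase hj)
  have hfl := hf l hls
  have hmem : k (v l) / f (v l) ∈ segment ℝ (k (v i) / f (v i)) (k (v j) / f (v j)) := by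
    rw [segment_eq_Icc ((hmin l hls).trans (hmax l hl'))]
    exact ⟨hmin l hls, hmax l hl'⟩
  obtain ⟨a, b, ha, hb, hab, hc⟩ := hmem
  refine ⟨f (v l) * a / f (v i), f (v l) * b / f (v j), by positivity, by positivity,
    sub_eq_zero.1 (hk _ ?_ ?_)⟩
  · simp only [map_sub, map_add, map_smul, smul_eq_mul]
    rw [div_mul_cancel₀ _ hfi.ne', div_mul_cancel₀ _ hfj.ne', ← mul_add, hab]
    ring
  · simp only [map_sub, map_add, map_smul, smul_eq_mul] at hc ⊢
    have h := congrArg (f (v l) * ·) hc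
    simp only [mul_div_cancel₀ _ hfl.ne'] at h
    linear_combination -h

lemma one_le_norm_sum_of_odd (hdim : Module.finrank ℝ E = 2) {ι : Type*} {v : ι → E}
    (hv : ∀ i, ‖v i‖ = 1)
    (h3 : ∀ i j k : ι, i ≠ j → i ≠ k → j ≠ k → 1 ≤ ‖v i + v j + v k‖)
    (s : Finset ι) (hs : Odd s.card) : 1 ≤ ‖∑ i ∈ s, v i‖ := by
  classical
  induction s using Finset.strongInduction with
  | H s ih =>
    have step {i j : ι} (hi : i ∈ s) (hj : j ∈ s.erase i) :
        1 ≤ ‖∑ l ∈ (s.erase i).erase j, v l‖ := by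
      refine ih _ ((Finset.erase_subset _ _).trans_ssubset (Finset.erase_ssubset hi)) ?_
      have h1 : 0 < (s.erase i).card := Finset.card_pos.2 ⟨j, hj⟩
      have h2 := Finset.card_erase_of_mem hi
      rw [Finset.card_erase_of_mem hj]
      grind
    by_cases hanti : ∃ i ∈ s, ∃ j ∈ s, v i = -v j
    · obtain ⟨i, hi, j, hj, hij⟩ := hanti
      have hne : j ≠ i := by
        rintro rfl
        have h2 : (2 : ℝ) • v j = 0 := by rw [two_smul, ← eq_neg_iff_add_eq_zero, ← hij]
        have := hv j
        simp [(smul_eq_zero.1 h2).resolve_left two_ne_zero] at this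
      have hj' := Finset.mem_erase.2 ⟨hne, hj⟩
      rw [← Finset.add_sum_erase s v hi, ← Finset.add_sum_erase _ v hj', hij,
        neg_add_cancel_left]
      exact step hi hj'
    push Not at hanti
    by_cases h0 : (0 : E) ∈ convexHull ℝ (v '' s)
    · exact one_le_norm_sum_of_zero_mem_convexHull hdim hs hv h3 hanti h0
    obtain ⟨f, u, hu, hf⟩ := geometric_hahn_banach_point_closed (convex_convexHull ℝ (v '' s))
      ((s.finite_toSet.image v).isClosed_convexHull ℝ) h0
    have hpos (i : ι) (hi : i ∈ s) : 0 < f (v i) :=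
      (map_zero f ▸ hu).trans (hf _ (subset_convexHull ℝ _ (Set.mem_image_of_mem v hi)))
    rcases (Nat.succ_le_of_lt hs.pos).eq_or_lt with h1 | h1
    · obtain ⟨i, rfl⟩ := Finset.card_eq_one.1 h1.symm
      simp [hv]
    obtain ⟨i, hi, j, hj, hcone⟩ := exists_cone_of_pos hdim h1 f.toLinearMap hpos
    choose! a b ha hb hab using hcone
    have hsum : ∑ l ∈ (s.erase i).erase j, v l = (∑ l ∈ (s.erase i).erase j, a l) • v i +
        (∑ l ∈ (s.erase i).erase j, b l) • v j := by
      rw [Finset.sum_congr rfl hab, Finset.sum_add_distrib, Finset.sum_smul, Finset.sum_smul]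
    have hle := norm_le_norm_add_add_of_mem_cone (hv i) (hv j)
      (Finset.sum_nonneg ha) (Finset.sum_nonneg hb)
    rw [← hsum] at hle
    refine (step hi hj).trans (hle.trans_eq ?_)
    rw [← Finset.add_sum_erase s v hi, ← Finset.add_sum_erase _ v hj]
    congr 1
    abel

end NormedPlane

/-- Theorem 2 (Helly type): if `n ≥ 3` is odd, the `v i` are unit vectors in a normed
plane `E`, and every 3-sum over distinct indices has norm at least 1, then the total
sum has norm at least 1. -/
theorem sum_norm_ge_one_of_three_sums
    {E : Type*} [NormedAddCommGroup E] [NormedSpace ℝ E]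
    (hdim : Module.finrank ℝ E = 2)
    {n : ℕ} (hn : 3 ≤ n) (hodd : Odd n)
    (v : Fin n → E) (hv : ∀ i, ‖v i‖ = 1)
    (h3 : ∀ i j k : Fin n, i ≠ j → i ≠ k → j ≠ k → 1 ≤ ‖v i + v j + v k‖) :
    1 ≤ ‖∑ i, v i‖ :=
  one_le_norm_sum_of_odd hdim hv h3 Finset.univ (by simpa using hodd)
end

section
/- Let n ≥ 3 be an odd integer and let v_1, …, v_n be vectors in E with ‖v_i‖ ≤ 1 for every i. If for all pairwise distinct indices i, j, k one has ‖v_i + v_j + v_k‖ > 1, then ‖v_1 + v_2 + ⋯ + v_n‖ > 1. -/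
theorem norm_smul_add_smul_le_abs {E : Type*} [NormedAddCommGroup E] [NormedSpace ℝ E]
    {a b : E} (ha : ‖a‖ ≤ 1) (hb : ‖b‖ ≤ 1) (s t : ℝ) :
    ‖s • a + t • b‖ ≤ |s| + |t| := by
  refine (norm_add_le _ _).trans (add_le_add ?_ ?_)
  · rw [norm_smul, Real.norm_eq_abs]
    exact mul_le_of_le_one_right (abs_nonneg s) ha
  · rw [norm_smul, Real.norm_eq_abs]
    exact mul_le_of_le_one_right (abs_nonneg t) hb

/-- If three vectors of the unit ball have a nonnegative linear dependency and their sum leaves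
the ball, one coefficient exceeds the sum of the other two. -/
theorem coeff_dominates_of_one_lt_norm_add {E : Type*} [NormedAddCommGroup E] [NormedSpace ℝ E]
    {a b c : E} (ha : ‖a‖ ≤ 1) (hb : ‖b‖ ≤ 1) (hc : ‖c‖ ≤ 1) {α β γ : ℝ}
    (hα : 0 ≤ α) (hβ : 0 ≤ β) (hγ : 0 ≤ γ) (hpos : 0 < α + β + γ)
    (h0 : α • a + β • b + γ • c = 0) (h : 1 < ‖a + b + c‖) :
    β + γ < α ∨ α + γ < β ∨ α + β < γ := by
  have key : ∀ {a b c : E} {α β γ : ℝ}, ‖b‖ ≤ 1 → ‖c‖ ≤ 1 → 0 ≤ β → 0 ≤ γ → 0 < α → β ≤ α →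
      γ ≤ α → α • a + β • b + γ • c = 0 → 1 < ‖a + b + c‖ → β + γ < α := by
    intro a b c α β γ hb hc hβ hγ hα hβα hγα h0 h
    have e : a + b + c = (1 - β / α) • b + (1 - γ / α) • c := by
      have : a = -((β / α) • b) - (γ / α) • c := by
        have h1 : α • a = -(β • b) - γ • c := by
          rw [← sub_eq_zero, ← h0]; abel
        calc a = α⁻¹ • (α • a) := by rw [inv_smul_smul₀ hα.ne']
          _ = _ := by rw [h1]; module
      rw [this]; module
    have h1 := norm_smul_add_smul_le_abs hb hc (1 - β / α) (1 - γ / α)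
    rw [← e, abs_of_nonneg (sub_nonneg.2 ((div_le_one hα).2 hβα)),
      abs_of_nonneg (sub_nonneg.2 ((div_le_one hα).2 hγα))] at h1
    have h2 : (β + γ) / α < 1 := by rw [add_div]; linarith
    rwa [div_lt_one hα] at h2
  rcases le_total α β with h1 | h1 <;> rcases le_total β γ with h2 | h2 <;>
    rcases le_total α γ with h3 | h3
  all_goals first
    | exact Or.inl (key hb hc hβ hγ (by linarith) (by linarith) (by linarith) h0 h)
    | exact Or.inr (Or.inl (key ha hc hα hγ (by linarith) (by linarith) (by linarith)
        (by rw [← h0]; abel) (by rwa [add_comm b a])))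
    | exact Or.inr (Or.inr (key ha hb hα hβ (by linarith) (by linarith) (by linarith)
        (by rw [← h0]; abel) (by rwa [add_assoc, add_comm c])))

theorem norm_sub_sub_le_one_of_eq_combination {E : Type*} [NormedAddCommGroup E] [NormedSpace ℝ E]
    {a b c x : E} (ha : ‖a‖ ≤ 1) (hb : ‖b‖ ≤ 1) (hc : ‖c‖ ≤ 1) {l m k : ℝ}
    (hl : 0 ≤ l) (hm : 0 ≤ m) (hk : 0 ≤ k) (hsum : l + m + k = 1)
    (hx : x = l • a + m • b + k • (a + b + c)) : ‖x - a - b‖ ≤ 1 := by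
  have e : x - a - b = k • c + ((-m) • a + (-l) • b) := by
    rw [hx, show k = 1 - l - m by linarith]; module
  have h1 := norm_smul_add_smul_le_abs ha hb (-m) (-l)
  have h2 : ‖k • c‖ ≤ k := by
    rw [norm_smul, Real.norm_of_nonneg hk]; exact mul_le_of_le_one_right hk hc
  rw [abs_neg, abs_neg, abs_of_nonneg hm, abs_of_nonneg hl] at h1
  rw [e]
  linarith [norm_add_le (k • c) ((-m) • a + (-l) • b)]

/-- In a normed plane, the triangle spanned by three points of the unit ball is covered by the
translates of the ball by the pairwise sums of these points. -/
theorem exists_norm_sub_sub_le_one_of_mem_triangle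
    {E : Type*} [NormedAddCommGroup E] [NormedSpace ℝ E] (hdim : Module.finrank ℝ E = 2)
    {a b c x : E} (ha : ‖a‖ ≤ 1) (hb : ‖b‖ ≤ 1) (hc : ‖c‖ ≤ 1) {α β γ : ℝ}
    (hα : 0 ≤ α) (hβ : 0 ≤ β) (hγ : 0 ≤ γ) (hsum : α + β + γ = 1)
    (hx : x = α • a + β • b + γ • c) :
    ‖x - a - b‖ ≤ 1 ∨ ‖x - a - c‖ ≤ 1 ∨ ‖x - b - c‖ ≤ 1 := by
  have : FiniteDimensional ℝ E := Module.finite_of_finrank_pos (by omega)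
  obtain ⟨r, s, t, q, hne, hq, h0, hrel⟩ : ∃ r s t q : ℝ, (r < 0 ∨ s < 0 ∨ t < 0) ∧ 0 ≤ q ∧
      r + s + t + q = 0 ∧ r • a + s • b + t • c + q • (a + b + c) = 0 := by
    have hdep : ¬ AffineIndependent ℝ ![a, b, c, a + b + c] := by
      intro h
      have h1 := h.card_le_finrank_succ
      have h2 := Submodule.finrank_le (vectorSpan ℝ (Set.range ![a, b, c, a + b + c]))
      simp only [Fintype.card_fin] at h1
      omega
    rw [affineIndependent_iff_of_fintype] at hdep
    push Not at hdep
    obtain ⟨w, hw, hw0, i, hi⟩ := hdep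
    rw [Finset.univ.weightedVSub_eq_linear_combination hw] at hw0
    simp only [Fin.sum_univ_four, Matrix.cons_val] at hw hw0
    have hi' : w 0 ≠ 0 ∨ w 1 ≠ 0 ∨ w 2 ≠ 0 ∨ w 3 ≠ 0 := by
      fin_cases i
      exacts [Or.inl hi, Or.inr (Or.inl hi), Or.inr (Or.inr (Or.inl hi)),
        Or.inr (Or.inr (Or.inr hi))]
    rcases le_or_gt 0 (w 3) with h3 | h3
    · by_cases hn : w 0 < 0 ∨ w 1 < 0 ∨ w 2 < 0
      · exact ⟨w 0, w 1, w 2, w 3, hn, h3, hw, hw0⟩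
      · push Not at hn
        exfalso
        rcases hi' with h | h | h | h <;> exact h (by linarith)
    · by_cases hn : 0 < w 0 ∨ 0 < w 1 ∨ 0 < w 2
      · refine ⟨-w 0, -w 1, -w 2, -w 3, by simpa using hn, by linarith, by linarith, ?_⟩
        rw [← neg_eq_zero.2 hw0]; module
      · push Not at hn
        linarith
  have hred : ∃ l m k j : ℝ, 0 ≤ l ∧ 0 ≤ m ∧ 0 ≤ k ∧ 0 ≤ j ∧ l + m + k + j = 1 ∧
      (l = 0 ∨ m = 0 ∨ k = 0) ∧ x = l • a + m • b + k • c + j • (a + b + c) := by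
    -- move along the dependency until the first coefficient vanishes
    have aux : ∀ θ : ℝ, 0 ≤ θ → 0 ≤ α + θ * r → 0 ≤ β + θ * s → 0 ≤ γ + θ * t →
        (α + θ * r = 0 ∨ β + θ * s = 0 ∨ γ + θ * t = 0) →
        ∃ l m k j : ℝ, 0 ≤ l ∧ 0 ≤ m ∧ 0 ≤ k ∧ 0 ≤ j ∧ l + m + k + j = 1 ∧
          (l = 0 ∨ m = 0 ∨ k = 0) ∧ x = l • a + m • b + k • c + j • (a + b + c) := by
      intro θ hθ h1 h2 h3 h4
      refine ⟨_, _, _, θ * q, h1, h2, h3, by positivity, by linear_combination hsum + θ * h0,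
        h4, ?_⟩
      have : θ • (r • a + s • b + t • c + q • (a + b + c)) = 0 := by rw [hrel, smul_zero]
      rw [hx, ← sub_eq_zero, ← neg_eq_zero, ← this]; module
    let f : Fin 3 → ℝ := ![α, β, γ]
    let d : Fin 3 → ℝ := ![r, s, t]
    have hf : ∀ i, 0 ≤ f i := by
      intro i; fin_cases i
      exacts [hα, hβ, hγ]
    have hS : (Finset.univ.filter fun i => d i < 0).Nonempty := by
      rcases hne with h | h | h
      exacts [⟨0, by simpa [d] using h⟩, ⟨1, by simpa [d] using h⟩, ⟨2, by simpa [d] using h⟩]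
    obtain ⟨i, hi, hmin⟩ := Finset.exists_min_image _ (fun i => f i / -d i) hS
    have hi0 : d i < 0 := (Finset.mem_filter.1 hi).2
    have hθ : 0 ≤ f i / -d i := div_nonneg (hf i) (by linarith)
    have hge : ∀ j, 0 ≤ f j + f i / -d i * d j := by
      intro j
      rcases lt_or_ge (d j) 0 with hj | hj
      · have h1 := hmin j (by simpa using hj)
        rw [le_div_iff₀ (by linarith)] at h1
        linarith
      · have := hf j
        positivity
    have hzero : f i + f i / -d i * d i = 0 := by
      have := hi0.ne
      field_simp
      ring
    refine aux _ hθ (hge 0) (hge 1) (hge 2) ?_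
    generalize f i / -d i = θ at hzero
    fin_cases i
    exacts [Or.inl hzero, Or.inr (Or.inl hzero), Or.inr (Or.inr hzero)]
  obtain ⟨l, m, k, j, hl, hm, hk, hj, hs, hz, hx'⟩ := hred
  rcases hz with rfl | rfl | rfl
  · refine Or.inr (Or.inr (norm_sub_sub_le_one_of_eq_combination hb hc ha hm hk hj
      (by linarith) ?_))
    rw [hx']; module
  · refine Or.inr (Or.inl (norm_sub_sub_le_one_of_eq_combination ha hc hb hl hk hj
      (by linarith) ?_))
    rw [hx']; module
  · refine Or.inl (norm_sub_sub_le_one_of_eq_combination ha hb hc hl hm hj (by linarith) ?_)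
    rw [hx']; module

/-- Carathéodory's theorem in the plane, for an indexed family with at least three members. -/
theorem exists_three_of_eq_sum_smul {ι E : Type*} [DecidableEq ι] [AddCommGroup E] [Module ℝ E]
    (hdim : Module.finrank ℝ E = 2) {v : ι → E} {s : Finset ι} (hs : 3 ≤ s.card)
    {w : ι → ℝ} (hw : ∀ i ∈ s, 0 ≤ w i) (hw1 : ∑ i ∈ s, w i = 1) :
    ∃ i ∈ s, ∃ j ∈ s, ∃ k ∈ s, i ≠ j ∧ i ≠ k ∧ j ≠ k ∧ ∃ α β γ : ℝ, 0 ≤ α ∧ 0 ≤ β ∧ 0 ≤ γ ∧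
      α + β + γ = 1 ∧ ∑ i ∈ s, w i • v i = α • v i + β • v j + γ • v k := by
  have : FiniteDimensional ℝ E := Module.finite_of_finrank_pos (by omega)
  have hmem : ∑ i ∈ s, w i • v i ∈ convexHull ℝ (v '' s) := by
    refine (convex_convexHull ℝ _).sum_mem hw hw1 fun i hi => subset_convexHull ℝ _ ?_
    exact Set.mem_image_of_mem v hi
  obtain ⟨κ, _, z, u, hz, hind, hu, hu1, hx⟩ := eq_pos_convex_span_of_mem_convexHull hmem
  have hcard : Fintype.card κ ≤ 3 := by
    have h1 := hind.card_le_finrank_succ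
    have h2 := Submodule.finrank_le (vectorSpan ℝ (Set.range z))
    omega
  choose g hgs hg using fun i => hz (Set.mem_range_self i)
  have hsub : Finset.univ.image g ⊆ s := by
    intro i hi
    obtain ⟨l, -, rfl⟩ := Finset.mem_image.1 hi
    exact hgs l
  obtain ⟨t, ht1, ht2, ht3⟩ := Finset.exists_subsuperset_card_eq hsub
    (Finset.card_image_le.trans hcard) hs
  obtain ⟨i, j, k, hij, hik, hjk, rfl⟩ := Finset.card_eq_three.1 ht3
  have hmem' : ∑ i ∈ s, w i • v i ∈ convexHull ℝ ({v i, v j, v k} : Set E) := by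
    rw [← hx]
    refine (convex_convexHull ℝ _).sum_mem (fun l _ => (hu l).le) hu1 fun l _ =>
      subset_convexHull ℝ _ ?_
    have : g l ∈ ({i, j, k} : Finset ι) := ht1 (Finset.mem_image_of_mem g (Finset.mem_univ l))
    rw [← hg l]
    simp only [Finset.mem_insert, Finset.mem_singleton] at this
    rcases this with h | h | h <;> simp [h]
  rw [convexHull_insert (by simp), convexHull_pair] at hmem'
  simp only [segment_eq_image, Set.mem_image, convexJoin_singleton_left, Set.mem_iUnion] at hmem'
  obtain ⟨y, ⟨θ, ⟨hθ0, hθ1⟩, rfl⟩, φ, ⟨hφ0, hφ1⟩, hφ⟩ := hmem'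
  refine ⟨i, ht2 (by simp), j, ht2 (by simp), k, ht2 (by simp), hij, hik, hjk, 1 - φ,
    φ * (1 - θ), φ * θ, by linarith, mul_nonneg hφ0 (by linarith), mul_nonneg hφ0 hθ0,
    by ring, ?_⟩
  rw [← hφ]; module

theorem exists_pair_norm_sub_sub_le_one {ι E : Type*} [DecidableEq ι] [NormedAddCommGroup E]
    [NormedSpace ℝ E] (hdim : Module.finrank ℝ E = 2) {v : ι → E} (hv : ∀ i, ‖v i‖ ≤ 1)
    {s : Finset ι} (hs : 3 ≤ s.card) {w : ι → ℝ} (hw : ∀ i ∈ s, 0 ≤ w i)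
    (hw1 : ∑ i ∈ s, w i = 1) :
    ∃ i ∈ s, ∃ j ∈ s, i ≠ j ∧ ‖∑ i ∈ s, w i • v i - v i - v j‖ ≤ 1 := by
  obtain ⟨i, hi, j, hj, k, hk, hij, hik, hjk, α, β, γ, hα, hβ, hγ, hsum, hx⟩ :=
    exists_three_of_eq_sum_smul hdim (v := v) hs hw hw1
  rcases exists_norm_sub_sub_le_one_of_mem_triangle hdim (hv i) (hv j) (hv k) hα hβ hγ hsum hx
    with h | h | h
  exacts [⟨i, hi, j, hj, hij, h⟩, ⟨i, hi, k, hk, hik, h⟩, ⟨j, hj, k, hk, hjk, h⟩]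

/-- `-v e` is a nonnegative combination of the other vectors with total weight less than one. -/
def IsNegDominated {ι E : Type*} [Fintype ι] [AddCommGroup E] [Module ℝ E] (v : ι → E) (e : ι) :
    Prop :=
  ∃ u : ι → ℝ, (∀ i, 0 ≤ u i) ∧ u e = 0 ∧ ∑ i, u i < 1 ∧ ∑ i, u i • v i = -v e

theorem IsNegDominated.abs_lt_one {ι E : Type*} [Fintype ι] [AddCommGroup E] [Module ℝ E]
    {v : ι → E} {e : ι} (he : IsNegDominated v e) (g : E →ₗ[ℝ] ℝ) (hg : ∀ i, |g (v i)| ≤ 1) :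
    |g (v e)| < 1 := by
  obtain ⟨u, hu, -, hu1, huv⟩ := he
  calc |g (v e)| = |∑ i, u i * g (v i)| := by
        rw [← abs_neg, ← map_neg, ← huv, map_sum]; simp
    _ ≤ ∑ i, |u i * g (v i)| := Finset.abs_sum_le_sum_abs _ _
    _ ≤ ∑ i, u i := Finset.sum_le_sum fun i _ => by
        rw [abs_mul, abs_of_nonneg (hu i)]; exact mul_le_of_le_one_right (hu i) (hg i)
    _ < 1 := hu1

theorem isNegDominated_of_eq_add {ι E : Type*} [Fintype ι] [DecidableEq ι] [AddCommGroup E]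
    [Module ℝ E] {v : ι → E} {e a b : ι} (ha : e ≠ a) (hb : e ≠ b) {α β γ : ℝ} (hα : 0 ≤ α)
    (hβ : 0 ≤ β) (h : α + β < γ) (h0 : γ • v e + α • v a + β • v b = 0) :
    IsNegDominated v e := by
  have hγ : 0 < γ := by linarith
  refine ⟨Pi.single a (α / γ) + Pi.single b (β / γ), fun i => ?_, by simp [ha, hb], ?_, ?_⟩
  · have h1 : (0 : ι → ℝ) ≤ Pi.single a (α / γ) := Pi.single_nonneg.2 (by positivity)
    have h2 : (0 : ι → ℝ) ≤ Pi.single b (β / γ) := Pi.single_nonneg.2 (by positivity)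
    exact add_nonneg (h1 i) (h2 i)
  · simp only [Pi.add_apply, Finset.sum_add_distrib, Finset.sum_pi_single', Finset.mem_univ,
      if_true]
    rwa [← add_div, div_lt_one hγ]
  · simp only [Pi.add_apply, add_smul, Finset.sum_add_distrib, Pi.single_apply, ite_smul, zero_smul,
      Finset.sum_ite_eq', Finset.mem_univ, if_true]
    have : γ⁻¹ • (γ • v e + α • v a + β • v b) = 0 := by rw [h0, smul_zero]
    rw [smul_add, smul_add, inv_smul_smul₀ hγ.ne'] at this
    rw [← sub_eq_zero, ← this]
    module

theorem sum_smul_ne_neg_of_three_sums {ι E : Type*} [Fintype ι] [DecidableEq ι]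
    [NormedAddCommGroup E] [NormedSpace ℝ E] (hdim : Module.finrank ℝ E = 2) {v : ι → E}
    (hv : ∀ i, ‖v i‖ ≤ 1) (hcard : 4 ≤ Fintype.card ι)
    (h3 : ∀ i j k, i ≠ j → i ≠ k → j ≠ k → 1 < ‖v i + v j + v k‖)
    {d : ι} {w : ι → ℝ} (hw : ∀ i, 0 ≤ w i) (hd : w d = 0) (hw1 : ∑ i, w i = 1) :
    ∑ i, w i • v i ≠ -v d := by
  intro h
  have hs : 3 ≤ (Finset.univ.erase d).card := by
    rw [Finset.card_erase_of_mem (Finset.mem_univ d), Finset.card_univ]; omega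
  have e1 : ∑ i ∈ Finset.univ.erase d, w i = 1 := by
    rw [← hw1]; exact Finset.sum_erase _ hd
  have e2 : ∑ i ∈ Finset.univ.erase d, w i • v i = -v d := by
    rw [← h]; exact Finset.sum_erase _ (by simp [hd])
  obtain ⟨i, hi, j, hj, hij, hle⟩ :=
    exists_pair_norm_sub_sub_le_one hdim hv hs (fun i _ => hw i) e1
  rw [e2, show -v d - v i - v j = -(v d + v i + v j) by abel, norm_neg] at hle
  exact absurd (h3 d i j (Finset.ne_of_mem_erase hi).symm (Finset.ne_of_mem_erase hj).symm hij)
    hle.not_gt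

theorem exists_isNegDominated {ι E : Type*} [Fintype ι] [DecidableEq ι]
    [NormedAddCommGroup E] [NormedSpace ℝ E] (hdim : Module.finrank ℝ E = 2) {v : ι → E}
    (hv : ∀ i, ‖v i‖ ≤ 1) (hcard : 4 ≤ Fintype.card ι)
    (h3 : ∀ i j k, i ≠ j → i ≠ k → j ≠ k → 1 < ‖v i + v j + v k‖)
    {w : ι → ℝ} (hw : ∀ i, 0 ≤ w i) (hw0 : 0 < ∑ i, w i) (h0 : ∑ i, w i • v i = 0) :
    ∃ e, IsNegDominated v e := by
  obtain ⟨i, -, j, -, k, -, hij, hik, hjk, α, β, γ, hα, hβ, hγ, hsum, hx⟩ :=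
    exists_three_of_eq_sum_smul hdim (v := v) (s := Finset.univ) (w := fun i => w i / ∑ i, w i)
      (by rw [Finset.card_univ]; omega) (fun i _ => div_nonneg (hw i) hw0.le)
      (by rw [← Finset.sum_div, div_self hw0.ne'])
  have e : ∑ l, (w l / ∑ i, w i) • v l = 0 := by
    simp only [div_eq_inv_mul, mul_smul]
    rw [← Finset.smul_sum, h0, smul_zero]
  rw [e] at hx
  rcases coeff_dominates_of_one_lt_norm_add (hv i) (hv j) (hv k) hα hβ hγ (by linarith) hx.symm
    (h3 i j k hij hik hjk) with h | h | h
  · exact ⟨i, isNegDominated_of_eq_add hij hik hβ hγ h hx.symm⟩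
  · exact ⟨j, isNegDominated_of_eq_add hij.symm hjk hα hγ h (by rw [hx]; abel)⟩
  · exact ⟨k, isNegDominated_of_eq_add hik.symm hjk.symm hα hβ h (by rw [hx]; abel)⟩

/-- The vectors other than a dominated one satisfy no nontrivial nonnegative dependency. -/
theorem IsNegDominated.sum_nonpos {ι E : Type*} [Fintype ι] [DecidableEq ι]
    [NormedAddCommGroup E] [NormedSpace ℝ E] (hdim : Module.finrank ℝ E = 2) {v : ι → E}
    (hv : ∀ i, ‖v i‖ ≤ 1) (hcard : 4 ≤ Fintype.card ι)
    (h3 : ∀ i j k, i ≠ j → i ≠ k → j ≠ k → 1 < ‖v i + v j + v k‖)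
    {e : ι} (he : IsNegDominated v e) {w : ι → ℝ} (hw : ∀ i, 0 ≤ w i) (hwe : w e = 0)
    (h0 : ∑ i, w i • v i = 0) : ∑ i, w i ≤ 0 := by
  by_contra! hpos
  obtain ⟨u, hu, hue, hu1, huv⟩ := he
  refine sum_smul_ne_neg_of_three_sums hdim hv hcard h3 (d := e)
    (w := fun i => u i + (1 - ∑ j, u j) / (∑ j, w j) * w i) (fun i => ?_) (by simp [hue, hwe]) ?_ ?_
  · have := hu i
    have := hw i
    have : 0 ≤ (1 - ∑ j, u j) / (∑ j, w j) := div_nonneg (by linarith) hpos.le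
    positivity
  · rw [Finset.sum_add_distrib, ← Finset.mul_sum, div_mul_cancel₀ _ hpos.ne']
    ring
  · simp only [add_smul, mul_smul, Finset.sum_add_distrib]
    rw [← Finset.smul_sum, h0, huv, smul_zero, add_zero]

theorem IsNegDominated.add_smul_add_smul_sum_ne_zero {ι E : Type*} [Fintype ι] [DecidableEq ι]
    [NormedAddCommGroup E] [NormedSpace ℝ E] (hdim : Module.finrank ℝ E = 2) {v : ι → E}
    (hv : ∀ i, ‖v i‖ ≤ 1) (hcard : 4 ≤ Fintype.card ι)
    (h3 : ∀ i j k, i ≠ j → i ≠ k → j ≠ k → 1 < ‖v i + v j + v k‖)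
    {e a b : ι} (he : IsNegDominated v e) (ha : e ≠ a) (hb : e ≠ b) {s t : ℝ} (hs : 0 ≤ s)
    (ht : 0 ≤ t) : v a + t • v b + s • ∑ i, v i ≠ 0 := by
  intro h
  obtain ⟨u, hu, hue, hu1, huv⟩ := id he
  have hle : ∀ j, u j ≤ 1 := fun j =>
    (Finset.single_le_sum (fun i _ => hu i) (Finset.mem_univ j)).trans hu1.le
  let w : ι → ℝ := fun j => (if j = a then 1 else 0) + t * (if j = b then 1 else 0) +
    s * (1 - u j - if j = e then 1 else 0)
  have hw : ∀ j, 0 ≤ w j := by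
    intro j
    have h1 : (0 : ℝ) ≤ 1 - u j - if j = e then 1 else 0 := by
      split_ifs with hj
      · rw [hj, hue]; norm_num
      · linarith [hle j]
    have h2 : (0 : ℝ) ≤ if j = a then 1 else 0 := by split_ifs <;> norm_num
    have h3 : (0 : ℝ) ≤ if j = b then 1 else 0 := by split_ifs <;> norm_num
    exact add_nonneg (add_nonneg h2 (mul_nonneg ht h3)) (mul_nonneg hs h1)
  have h1 := he.sum_nonpos hdim hv hcard h3 hw (by simp [w, ha, hb, hue]) (by
    simp only [w, add_smul, mul_smul, sub_smul, Finset.sum_add_distrib, ← Finset.smul_sum,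
      Finset.sum_sub_distrib, ite_smul, one_smul, zero_smul, Finset.sum_ite_eq', Finset.mem_univ,
      if_true, huv]
    rw [← h]; module)
  have h2 : w a ≤ ∑ i, w i := Finset.single_le_sum (fun i _ => hw i) (Finset.mem_univ a)
  have h4 : 1 ≤ w a := by
    have : 0 ≤ t * (if a = b then (1 : ℝ) else 0) := mul_nonneg ht (by split_ifs <;> norm_num)
    have := mul_nonneg hs (sub_nonneg.2 (hle a))
    simp only [w, if_true, ha.symm, if_false, sub_zero]
    linarith
  linarith

/-- If all differences `∑ v - v i - v j` leave the unit ball, the total sum does not lie in the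
convex hull of `0` and two of the vectors. -/
theorem one_lt_add_of_sum_eq_smul_add_smul {ι E : Type*} [Fintype ι] [DecidableEq ι]
    [NormedAddCommGroup E] [NormedSpace ℝ E] (hdim : Module.finrank ℝ E = 2) {v : ι → E}
    (hv : ∀ i, ‖v i‖ ≤ 1) (hcard : 4 ≤ Fintype.card ι)
    (hp : ∀ i j, i ≠ j → 1 < ‖∑ l, v l - v i - v j‖) {a b : ι} {s t : ℝ} (hs : 0 ≤ s)
    (ht : 0 ≤ t) (h : ∑ i, v i = s • v a + t • v b) : 1 < s + t := by
  by_contra! hle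
  have hn : (4 : ℝ) ≤ Fintype.card ι := by exact_mod_cast hcard
  set n : ℝ := (Fintype.card ι : ℝ)
  have hpos : 0 < n - (s + t) := by linarith
  set l : ℝ := (1 - (s + t)) / (n - (s + t))
  have hl0 : 0 ≤ l := div_nonneg (by linarith) hpos.le
  have hl1 : l ≤ 1 := (div_le_one hpos).2 (by linarith)
  have hln : l * (n - (s + t)) = 1 - (s + t) := div_mul_cancel₀ _ hpos.ne'
  let w : ι → ℝ := fun j => l + (1 - l) * (s * (if j = a then 1 else 0) +
    t * (if j = b then 1 else 0))
  have hw : ∀ j ∈ Finset.univ, 0 ≤ w j := by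
    intro j _
    have h2 : (0 : ℝ) ≤ if j = a then 1 else 0 := by split_ifs <;> norm_num
    have h3 : (0 : ℝ) ≤ if j = b then 1 else 0 := by split_ifs <;> norm_num
    have h4 : 0 ≤ 1 - l := by linarith
    positivity
  have hw1 : ∑ j, w j = 1 := by
    simp only [w, Finset.sum_add_distrib, ← Finset.mul_sum, Finset.sum_ite_eq', Finset.mem_univ,
      if_true, Finset.sum_const, Finset.card_univ, nsmul_eq_mul]
    linear_combination hln
  have hwv : ∑ j, w j • v j = ∑ j, v j := by
    simp only [w, add_smul, mul_smul, Finset.sum_add_distrib, ← Finset.smul_sum,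
      ite_smul, one_smul, zero_smul, Finset.sum_ite_eq', Finset.mem_univ, if_true]
    rw [← h]; module
  obtain ⟨i, -, j, -, hij, hle⟩ := exists_pair_norm_sub_sub_le_one hdim hv
    (by rw [Finset.card_univ]; omega) hw hw1
  rw [hwv] at hle
  exact absurd (hp i j hij) hle.not_gt

theorem exists_linearMap_ker_eq_span_singleton {E : Type*} [AddCommGroup E] [Module ℝ E]
    (hdim : Module.finrank ℝ E = 2) {p : E} (hp : p ≠ 0) :
    ∃ g : E →ₗ[ℝ] ℝ, LinearMap.ker g = Submodule.span ℝ {p} := by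
  have : FiniteDimensional ℝ E := Module.finite_of_finrank_pos (by omega)
  have h1 := Submodule.finrank_quotient_add_finrank (Submodule.span ℝ {p})
  rw [finrank_span_singleton hp, hdim] at h1
  let φ : (E ⧸ Submodule.span ℝ {p}) ≃ₗ[ℝ] ℝ :=
    LinearEquiv.ofFinrankEq _ _ (by rw [Module.finrank_self]; omega)
  exact ⟨φ.toLinearMap ∘ₗ (Submodule.span ℝ {p}).mkQ, by
    rw [LinearEquiv.ker_comp, Submodule.ker_mkQ]⟩

/-- The collinear case: the vectors cannot all be multiples of their sum. -/
theorem exists_ne_smul_sum {ι E : Type*} [Fintype ι] [DecidableEq ι]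
    [NormedAddCommGroup E] [NormedSpace ℝ E] (hdim : Module.finrank ℝ E = 2) {v : ι → E}
    (hv : ∀ i, ‖v i‖ ≤ 1) (hcard : 4 ≤ Fintype.card ι)
    (hp : ∀ i j, i ≠ j → 1 < ‖∑ l, v l - v i - v j‖) (hp0 : ∑ i, v i ≠ 0)
    (hp1 : ‖∑ i, v i‖ ≤ 1) (x : ι → ℝ) : ∃ i, v i ≠ x i • ∑ l, v l := by
  by_contra! hx
  set p := ∑ l, v l with hpdef
  have hsum : ∑ i, x i = 1 := by
    have : (∑ i, x i - 1) • p = 0 := by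
      rw [sub_smul, Finset.sum_smul, one_smul, sub_eq_zero]
      exact (Finset.sum_congr rfl fun i _ => (hx i).symm).trans hpdef.symm
    rcases smul_eq_zero.1 this with h | h
    · linarith
    · exact absurd h hp0
  have hlt : ∀ i, x i < 1 := by
    intro i
    by_contra! hi
    have hi0 : 0 < x i := by linarith
    have := one_lt_add_of_sum_eq_smul_add_smul hdim hv hcard hp (a := i) (b := i) (s := (x i)⁻¹)
      (t := 0) (by positivity) le_rfl (by
        rw [zero_smul, add_zero, hx i, inv_smul_smul₀ hi0.ne'])
    rw [add_zero] at this
    exact absurd (inv_le_one_of_one_le₀ hi) this.not_ge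
  obtain ⟨i, -, hi⟩ := Finset.exists_lt_of_sum_lt
    (s := Finset.univ) (f := fun _ : ι => (0 : ℝ)) (g := x) (by simp [hsum])
  have hneg : ∀ j ∈ Finset.univ.erase i, x j ≤ 0 := by
    intro j hj
    by_contra! hj0
    have h1 := hp i j (Finset.ne_of_mem_erase hj).symm
    have h2 : p - v i - v j = (1 - x i - x j) • p := by rw [hx i, hx j]; module
    rw [h2, norm_smul, Real.norm_eq_abs] at h1
    have h3 : |1 - x i - x j| ≤ 1 := by
      rw [abs_le]; constructor <;> linarith [hlt i, hlt j]
    exact absurd (mul_le_one₀ h3 (norm_nonneg _) hp1) h1.not_ge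
  have := Finset.sum_nonpos hneg
  have := Finset.add_sum_erase Finset.univ x (Finset.mem_univ i)
  linarith [hlt i]

/-- If all three-sums and all differences `∑ v - v i - v j` leave the unit ball, so does the
total sum. -/
theorem one_lt_norm_sum_of_one_lt_norm_sub_sub {ι E : Type*} [Fintype ι] [DecidableEq ι]
    [NormedAddCommGroup E] [NormedSpace ℝ E] (hdim : Module.finrank ℝ E = 2) {v : ι → E}
    (hv : ∀ i, ‖v i‖ ≤ 1) (hcard : 4 ≤ Fintype.card ι)
    (h3 : ∀ i j k, i ≠ j → i ≠ k → j ≠ k → 1 < ‖v i + v j + v k‖)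
    (hp : ∀ i j, i ≠ j → 1 < ‖∑ l, v l - v i - v j‖) : 1 < ‖∑ i, v i‖ := by
  by_contra! hp1
  have hne : Nonempty ι := Fintype.card_pos_iff.1 (by omega)
  have hp0 : ∑ i, v i ≠ 0 := by
    intro h
    have := one_lt_add_of_sum_eq_smul_add_smul hdim hv hcard hp (a := hne.some) (b := hne.some)
      (s := 0) (t := 0) le_rfl le_rfl (by rw [h]; simp)
    norm_num at this
  obtain ⟨g, b, hgp, hker, hgb, hg1⟩ : ∃ (g : E →ₗ[ℝ] ℝ) (b : ι), g (∑ i, v i) = 0 ∧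
      (∀ y, g y = 0 → ∃ c : ℝ, c • ∑ i, v i = y) ∧ g (v b) = -1 ∧ ∀ i, |g (v i)| ≤ 1 := by
    obtain ⟨g, hg⟩ := exists_linearMap_ker_eq_span_singleton hdim hp0
    obtain ⟨b, -, hb⟩ := Finset.exists_max_image Finset.univ (fun i => |g (v i)|)
      Finset.univ_nonempty
    have hker : ∀ y, g y = 0 → ∃ c : ℝ, c • ∑ i, v i = y := fun y hy =>
      Submodule.mem_span_singleton.1 (hg ▸ LinearMap.mem_ker.2 hy)
    have hgp : g (∑ i, v i) = 0 := by
      rw [← LinearMap.mem_ker, hg]; exact Submodule.mem_span_singleton_self _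
    have hb0 : g (v b) ≠ 0 := by
      intro h
      have h0 : ∀ i, g (v i) = 0 := fun i => by
        have := hb i (Finset.mem_univ i)
        rw [h, abs_zero] at this
        exact abs_nonpos_iff.1 this
      choose x hx using fun i => hker (v i) (h0 i)
      obtain ⟨i, hi⟩ := exists_ne_smul_sum hdim hv hcard hp hp0 hp1 x
      exact hi (hx i).symm
    refine ⟨(-(g (v b))⁻¹) • g, b, by rw [LinearMap.smul_apply, hgp, smul_zero],
      fun y hy => hker y ?_, by simp [hb0],
      fun i => ?_⟩
    · simpa [hb0] using hy
    · rw [LinearMap.smul_apply, smul_eq_mul, abs_mul, abs_neg, abs_inv, inv_mul_le_iff₀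
        (abs_pos.2 hb0), mul_one]
      exact hb i (Finset.mem_univ i)
  have hcoord : ∀ i, ∃ x : ℝ, v i = x • ∑ l, v l - g (v i) • v b := by
    intro i
    obtain ⟨c, hc⟩ := hker (v i + g (v i) • v b) (by simp [hgb])
    exact ⟨c, by rw [hc]; abel⟩
  choose x hx using hcoord
  set p := ∑ i, v i with hpdef
  set y : ι → ℝ := fun i => g (v i)
  change ∀ i, v i = x i • p - y i • v b at hx
  have hyb : y b = -1 := hgb
  have hball : ∀ s t : ℝ, ‖s • p + t • v b‖ ≤ |s| + |t| :=
    norm_smul_add_smul_le_abs hp1 (hv b)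
  have hneb : ∀ i, 0 < y i → i ≠ b := by
    rintro i hi rfl
    linarith
  have hshort : ∀ i, 0 < y i → 0 < x i → x i + y i < 1 := by
    intro i hi hxi
    by_contra! hge
    have h1 : p = (x i)⁻¹ • v i + (y i / x i) • v b := by
      have : x i • p = v i + y i • v b := by rw [hx i]; abel
      rw [div_eq_inv_mul, mul_smul, ← smul_add, ← this, inv_smul_smul₀ hxi.ne']
    have h2 := one_lt_add_of_sum_eq_smul_add_smul hdim hv hcard hp (by positivity)
      (by positivity) h1
    rw [inv_eq_one_div, ← add_div, one_lt_div hxi] at h2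
    have h3 := hp i b (hneb i hi)
    have h4 : p - v i - v b = (1 - x i) • p + (-(1 - y i)) • v b := by
      nth_rewrite 1 [hx i]; module
    rw [h4] at h3
    have hy1 : y i ≤ 1 := (abs_le.1 (hg1 i)).2
    have h5 : |1 - x i| ≤ y i := by rw [abs_le]; constructor <;> linarith
    have h6 : |-(1 - y i)| = 1 - y i := by rw [abs_neg, abs_of_nonneg (by linarith)]
    linarith [hball (1 - x i) (-(1 - y i))]
  have hrel : ∀ i, v i + y i • v b + (-x i) • p = 0 := by
    intro i
    nth_rewrite 1 [hx i]; module
  have hback : ∀ i, 0 < y i → x i ≤ 0 → IsNegDominated v i := by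
    intro i hi hxi
    obtain ⟨e, he⟩ : ∃ e, IsNegDominated v e := by
      have hi1 : (0 : ι → ℝ) ≤ Pi.single i 1 := Pi.single_nonneg.2 zero_le_one
      have hb1 : (0 : ι → ℝ) ≤ Pi.single b (y i) := Pi.single_nonneg.2 hi.le
      refine exists_isNegDominated hdim hv hcard h3
        (w := fun j => (Pi.single i 1 : ι → ℝ) j + (Pi.single b (y i) : ι → ℝ) j + -x i)
        (fun j => add_nonneg (add_nonneg (hi1 j) (hb1 j)) (by linarith)) ?_ ?_
      · simp only [Finset.sum_add_distrib, Finset.sum_pi_single', Finset.mem_univ, if_true,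
          Finset.sum_const, nsmul_eq_mul]
        have : (0 : ℝ) ≤ ((Finset.univ : Finset ι).card : ℝ) * -x i :=
          mul_nonneg (Nat.cast_nonneg _) (by linarith)
        linarith
      · rw [← hrel i]
        simp only [Finset.sum_add_distrib, add_smul, Pi.single_apply, ite_smul, one_smul,
          zero_smul, Finset.sum_ite_eq', Finset.mem_univ, if_true, ← Finset.smul_sum, ← hpdef]
    by_cases hei : e = i
    · rwa [← hei]
    have heb : e ≠ b := by
      rintro rfl
      have := he.abs_lt_one g hg1
      rw [hgb] at this
      norm_num at this
    exact absurd (hrel i) (he.add_smul_add_smul_sum_ne_zero hdim hv hcard h3 hei heb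
      (neg_nonneg.2 hxi) hi.le)
  have hunique : ∀ e i, IsNegDominated v e → e ≠ i → e ≠ b → 0 < y i → 0 < x i := by
    intro e i he hei heb hi
    by_contra! hxi
    exact he.add_smul_add_smul_sum_ne_zero hdim hv hcard h3 hei heb (neg_nonneg.2 hxi) hi.le (hrel i)
  have hylt : ∀ i, 0 < y i → y i < 1 := by
    intro i hi
    rcases lt_or_ge 0 (x i) with h | h
    · linarith [hshort i hi h]
    · exact (abs_lt.1 ((hback i hi h).abs_lt_one g hg1)).2
  have hysum : ∑ i, y i = 0 := by rw [← hgp, hpdef, map_sum]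
  obtain ⟨i, j, hij, hi, hj⟩ : ∃ i j, i ≠ j ∧ 0 < y i ∧ 0 < y j := by
    have h1 := Finset.add_sum_erase Finset.univ y (Finset.mem_univ b)
    obtain ⟨i, hib, hi⟩ := Finset.exists_lt_of_sum_lt
      (s := Finset.univ.erase b) (f := fun _ : ι => (0 : ℝ)) (g := y) (by
        rw [Finset.sum_const_zero]; linarith)
    have h2 := Finset.add_sum_erase _ y hib
    obtain ⟨j, hjb, hj⟩ := Finset.exists_lt_of_sum_lt
      (s := (Finset.univ.erase b).erase i) (f := fun _ : ι => (0 : ℝ)) (g := y) (by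
        rw [Finset.sum_const_zero]; linarith [hylt i hi])
    exact ⟨i, j, (Finset.ne_of_mem_erase hjb).symm, hi, hj⟩
  -- one of the two vectors has positive `p`-coordinate
  wlog hxi : 0 < x i generalizing i j
  · exact this j i hij.symm hj hi
      (hunique i j (hback i hi (not_lt.1 hxi)) hij (hneb i hi) hj)
  have hsi := hshort i hi hxi
  have hsj : x j + y j ≤ 1 := by
    rcases lt_or_ge 0 (x j) with h | h
    · exact (hshort j hj h).le
    · linarith [hylt j hj]
  have hneg : x i + x j < 0 := by
    by_contra! hge
    rcases le_total (y i + y j) (x i + x j) with h | h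
    · have h1 := hp i j hij
      have h2 : p - v i - v j = (1 - (x i + x j)) • p + (y i + y j) • v b := by
        nth_rewrite 1 [hx i, hx j]; module
      rw [h2] at h1
      have h4 := hball (1 - (x i + x j)) (y i + y j)
      rw [abs_of_pos (add_pos hi hj)] at h4
      have h5 : |1 - (x i + x j)| ≤ 1 - (y i + y j) := by
        rw [abs_le]; constructor <;> linarith
      linarith
    · have h1 := h3 b i j (hneb i hi).symm (hneb j hj).symm hij
      have h2 : v b + v i + v j = (x i + x j) • p + (1 - (y i + y j)) • v b := by
        nth_rewrite 1 [hx i, hx j]; module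
      rw [h2] at h1
      have h4 := hball (x i + x j) (1 - (y i + y j))
      rw [abs_of_nonneg hge] at h4
      have h5 : |1 - (y i + y j)| ≤ 1 - (x i + x j) := by
        rw [abs_le]; constructor <;> linarith
      linarith
  have hdep : x i • v j + (x i * y j - x j * y i) • v b + (-x j) • v i = 0 := by
    have h1 : x i • (v j + y j • v b + (-x j) • p) - x j • (v i + y i • v b + (-x i) • p) = 0 := by
      rw [hrel, hrel, smul_zero, smul_zero, sub_zero]
    rw [← h1]; module
  have hxj : 0 < -x j := by linarith
  have hβ : 0 < x i * y j - x j * y i := by nlinarith [mul_pos hxi hj, mul_pos hxj hi]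
  have hi1 := hylt i hi
  have hj1 := hylt j hj
  have hdom : x i + (x i * y j - x j * y i) < -x j := by
    rcases coeff_dominates_of_one_lt_norm_add (hv j) (hv b) (hv i) hxi.le hβ.le hxj.le
      (by linarith) hdep (h3 j b i (hneb j hj) hij.symm (hneb i hi).symm) with h | h | h
    · linarith
    · nlinarith
    · exact h
  have hdomi : IsNegDominated v i :=
    isNegDominated_of_eq_add hij (hneb i hi) hxi.le hβ.le hdom (by rw [← hdep]; abel)
  linarith [hunique i j hdomi hij (hneb i hi) hj]

theorem one_lt_norm_sum_finset_of_three_sums {ι E : Type*}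
    [NormedAddCommGroup E] [NormedSpace ℝ E] (hdim : Module.finrank ℝ E = 2) {v : ι → E}
    (hv : ∀ i, ‖v i‖ ≤ 1)
    (h3 : ∀ i j k, i ≠ j → i ≠ k → j ≠ k → 1 < ‖v i + v j + v k‖)
    (s : Finset ι) (hs : 3 ≤ s.card) (hodd : Odd s.card) : 1 < ‖∑ i ∈ s, v i‖ := by
  classical
  induction s using Finset.strongInduction with
  | H s ih =>
    rcases hs.eq_or_lt with h | h
    · obtain ⟨i, j, k, hij, hik, hjk, rfl⟩ := Finset.card_eq_three.1 h.symm
      rw [Finset.sum_insert (by simp [hij, hik]), Finset.sum_pair hjk, ← add_assoc]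
      exact h3 i j k hij hik hjk
    · rw [← Finset.sum_coe_sort]
      refine one_lt_norm_sum_of_one_lt_norm_sub_sub hdim (fun i : s => hv i)
        (by rw [Fintype.card_coe]; omega)
        (fun i j k hij hik hjk => h3 i j k (Subtype.coe_ne_coe.2 hij) (Subtype.coe_ne_coe.2 hik)
          (Subtype.coe_ne_coe.2 hjk)) fun i j hij => ?_
      have hj : (j : ι) ∈ s.erase i :=
        Finset.mem_erase.2 ⟨(Subtype.coe_ne_coe.2 hij).symm, j.2⟩
      have hc : ((s.erase i).erase j).card = s.card - 2 := by
        rw [Finset.card_erase_of_mem hj, Finset.card_erase_of_mem i.2]; omega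
      have := ih ((s.erase i).erase j)
        ((Finset.erase_ssubset hj).trans (Finset.erase_ssubset i.2))
        (by rw [hc]; obtain ⟨m, hm⟩ := hodd; omega)
        (by rw [hc]; exact Nat.Odd.sub_even (by omega) hodd even_two)
      rwa [Finset.sum_erase_eq_sub hj, Finset.sum_erase_eq_sub i.2, ← Finset.sum_coe_sort] at this

theorem sum_norm_gt_one_of_three_sums
    {E : Type*} [NormedAddCommGroup E] [NormedSpace ℝ E]
    (hdim : Module.finrank ℝ E = 2)
    {n : ℕ} (hn : 3 ≤ n) (hodd : Odd n)
    (v : Fin n → E) (hv : ∀ i, ‖v i‖ ≤ 1)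
    (h3 : ∀ i j k : Fin n, i ≠ j → i ≠ k → j ≠ k → 1 < ‖v i + v j + v k‖) :
    1 < ‖∑ i, v i‖ := by
  exact one_lt_norm_sum_finset_of_three_sums hdim hv h3 Finset.univ (by simpa using hn)
    (by simpa using hodd)
end

section
/- Let n ≥ 5 be an integer, let v_1, …, v_n be vectors in E with ‖v_i‖ ≤ 1 for every i, and let k be an odd integer with 3 < k ≤ n. If every 3-sum of the v_i has norm strictly greater than 1 (i.e. for every 3-element subset S of {1,…,n}, ‖∑_{i∈S} v_i‖ > 1), then every k-sum also has norm strictly greater than 1 (i.e. for every k-element subset S of {1,…,n}, ‖∑_{i∈S} v_i‖ > 1). -/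
/-- In a normed plane, translating by `q` only adds points to the unit ball on one side of a line
through the origin. -/
lemma exists_linearMap_norm_le_one_of_norm_sub_le_one
    {E : Type*} [NormedAddCommGroup E] [NormedSpace ℝ E]
    (hdim : Module.finrank ℝ E = 2) (q : E) :
    ∃ d : E →ₗ[ℝ] ℝ, ∀ x, ‖x - q‖ ≤ 1 → d x ≤ 0 → ‖x‖ ≤ 1 := by
  have : FiniteDimensional ℝ E := Module.finite_of_finrank_eq_succ hdim
  have : ProperSpace E := FiniteDimensional.proper_real E
  rcases eq_or_ne q 0 with rfl | hq
  · exact ⟨0, fun x hx _ => by simpa using hx⟩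
  obtain ⟨y, hy⟩ : ∃ y, y ∉ Submodule.span ℝ {q} := by
    by_contra! h
    have h1 := finrank_span_singleton (K := ℝ) hq
    rw [(Submodule.eq_top_iff').2 h, finrank_top] at h1
    omega
  obtain ⟨z, hz, hzd⟩ := (Submodule.closed_of_finiteDimensional
    (Submodule.span ℝ {q})).exists_infDist_eq_dist ⟨0, Submodule.zero_mem _⟩ y
  set m := y - z with hm
  have hmin (t : ℝ) : ‖m‖ ≤ ‖m + t • q‖ := by
    have h := Metric.infDist_le_dist_of_mem (x := y) (s := (Submodule.span ℝ {q} : Set E))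
      (y := z - t • q) (Submodule.sub_mem _ hz
        (Submodule.smul_mem _ _ (Submodule.mem_span_singleton_self q)))
    rw [hzd, dist_eq_norm, dist_eq_norm] at h
    rwa [show m + t • q = y - (z - t • q) by rw [hm]; abel]
  have hmq : m ∉ Submodule.span ℝ {q} := fun h => hy (by
    have := Submodule.add_mem _ h hz
    rwa [hm, sub_add_cancel] at this)
  have hind : LinearIndependent ℝ ![m, q] := by
    rw [LinearIndependent.pair_symm_iff, LinearIndependent.pair_iff' hq]
    exact fun t ht => hmq (ht ▸ Submodule.smul_mem _ _ (Submodule.mem_span_singleton_self q))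
  let b := basisOfLinearIndependentOfCardEqFinrank hind (by simp [hdim])
  have hb (x : E) : x = b.repr x 0 • m + b.repr x 1 • q := by
    conv_lhs => rw [← b.sum_repr x]
    simp [b, Fin.sum_univ_two]
  refine ⟨b.coord 1, fun x hx hd => ?_⟩
  rw [Module.Basis.coord_apply] at hd
  have hxe := hb x
  set c := b.repr x 0
  set d := b.repr x 1
  have hsub : x - q = c • m + (d - 1) • q := by
    rw [hxe]; module
  have hcm : ‖c • m‖ ≤ 1 := by
    rcases eq_or_ne c 0 with hc | hc
    · simp [hc]
    · calc ‖c • m‖ = ‖c‖ * ‖m‖ := norm_smul _ _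
        _ ≤ ‖c‖ * ‖m + (c⁻¹ * (d - 1)) • q‖ := by gcongr; exact hmin _
        _ = ‖x - q‖ := by
          rw [← norm_smul, hsub, smul_add, smul_smul, mul_inv_cancel_left₀ hc]
        _ ≤ 1 := hx
  have hd1 : 0 < 1 - d := by linarith
  have hconv : x = (1 / (1 - d)) • (c • m) + (-d / (1 - d)) • (x - q) := by
    have h1 : 1 / (1 - d) + -d / (1 - d) = 1 := by field_simp; ring
    have h2 : -d / (1 - d) * (d - 1) = d := by field_simp; ring
    calc x = c • m + d • q := hxe
      _ = (1 / (1 - d) + -d / (1 - d)) • (c • m) + (-d / (1 - d) * (d - 1)) • q := by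
        rw [h1, h2, one_smul]
      _ = _ := by rw [hsub]; module
  have hmem : (1 / (1 - d)) • (c • m) + (-d / (1 - d)) • (x - q) ∈ Metric.closedBall (0 : E) 1 :=
    convex_closedBall (0 : E) 1 (by simpa using hcm) (by simpa using hx) (by positivity)
      (div_nonneg (by linarith) hd1.le) (by field_simp; ring)
  rw [← hconv] at hmem
  simpa using hmem

/-- In a normed plane, the convex hull of points of the unit ball is covered by the unit balls
centred at these points. -/
lemma exists_norm_sub_sum_smul_le_one
    {E ι : Type*} [NormedAddCommGroup E] [NormedSpace ℝ E]
    (hdim : Module.finrank ℝ E = 2) (s : Finset ι) (v : ι → E) (hv : ∀ i ∈ s, ‖v i‖ ≤ 1)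
    (w : ι → ℝ) (hw : ∀ i ∈ s, 0 ≤ w i) (hw1 : ∑ i ∈ s, w i = 1) :
    ∃ i ∈ s, ‖v i - ∑ j ∈ s, w j • v j‖ ≤ 1 := by
  set p := ∑ j ∈ s, w j • v j with hp
  obtain ⟨d, hd⟩ := exists_linearMap_norm_le_one_of_norm_sub_le_one hdim (-p)
  by_contra! h
  have hpos : ∀ i ∈ s, 0 < d (v i - p) := fun i hi => by
    by_contra! h0
    exact (h i hi).not_ge (hd _ (by simpa using hv i hi) h0)
  have hsum : ∑ i ∈ s, w i * d (v i - p) = 0 := by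
    simp only [map_sub, mul_sub, Finset.sum_sub_distrib, ← Finset.sum_mul, hw1, one_mul]
    simp [hp]
  rw [Finset.sum_eq_zero_iff_of_nonneg fun i hi => mul_nonneg (hw i hi) (hpos i hi).le] at hsum
  have : ∑ i ∈ s, w i = 0 := Finset.sum_eq_zero fun i hi =>
    (mul_eq_zero.1 (hsum i hi)).resolve_right (hpos i hi).ne'
  linarith

/-- An extreme point of a slice of the cube by a system of linear equations has at most as many
fractional coordinates as there are equations. -/
lemma card_fractional_le_finrank_of_mem_extremePoints
    {ι W : Type*} [Fintype ι] [AddCommGroup W] [Module ℝ W] [FiniteDimensional ℝ W]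
    (L : (ι → ℝ) →ₗ[ℝ] W) (c : W) {a : ι → ℝ}
    (ha : a ∈ Set.extremePoints ℝ (Set.Icc 0 1 ∩ L ⁻¹' {c})) :
    (Finset.univ.filter fun i => 0 < a i ∧ a i < 1).card ≤ Module.finrank ℝ W := by
  by_contra! hcard
  set F := Finset.univ.filter fun i => 0 < a i ∧ a i < 1 with hF
  let ext : (F → ℝ) →ₗ[ℝ] (ι → ℝ) := Function.ExtendByZero.linearMap ℝ Subtype.val
  obtain ⟨β, hβ, hβ0⟩ := (Submodule.ne_bot_iff _).1
    ((L ∘ₗ ext).ker_ne_bot_of_finrank_lt (by simpa using hcard))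
  have hLβ : L (ext β) = 0 := hβ
  have hext (i : F) : ext β i = β i := by
    exact Subtype.val_injective.extend_apply _ _ _
  have hext0 (i : ι) (hi : i ∉ F) : ext β i = 0 := by
    have : ¬ ∃ j : F, j.1 = i := by rintro ⟨j, rfl⟩; exact hi j.2
    exact Function.extend_apply' _ _ _ this
  obtain ⟨⟨ha0, ha1⟩, haL⟩ := ha.1
  have hnear : ∀ᶠ t : ℝ in nhds 0, a + t • ext β ∈ Set.Icc (0 : ι → ℝ) 1 := by
    have : ∀ i, ∀ᶠ t : ℝ in nhds 0, 0 ≤ a i + t * ext β i ∧ a i + t * ext β i ≤ 1 := by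
      intro i
      by_cases hi : i ∈ F
      · have hcont : Filter.Tendsto (fun t : ℝ => a i + t * ext β i) (nhds 0) (nhds (a i)) := by
          have : Continuous fun t : ℝ => a i + t * ext β i := by fun_prop
          simpa using this.tendsto 0
        obtain ⟨h0, h1⟩ := (Finset.mem_filter.1 hi).2
        filter_upwards [hcont.eventually (lt_mem_nhds h0), hcont.eventually (gt_mem_nhds h1)]
          with t h h' using ⟨h.le, h'.le⟩
      · exact Filter.Eventually.of_forall fun t => by
          simpa [hext0 i hi] using ⟨ha0 i, ha1 i⟩
    filter_upwards [Filter.eventually_all.2 this] with t ht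
    exact ⟨fun i => (ht i).1, fun i => (ht i).2⟩
  obtain ⟨ε, hε, hball⟩ := Metric.eventually_nhds_iff.1 hnear
  have hmem (t : ℝ) (ht : |t| < ε) : a + t • ext β ∈ Set.Icc (0 : ι → ℝ) 1 ∩ L ⁻¹' {c} := by
    refine ⟨hball (by simpa using ht), ?_⟩
    simpa [hLβ] using haL
  have heq := ha.2 (hmem (ε / 2) (by rw [abs_of_pos (by positivity)]; linarith))
    (hmem (-(ε / 2)) (by rw [abs_neg, abs_of_pos (by positivity)]; linarith))
    ⟨1 / 2, 1 / 2, by norm_num, by norm_num, by norm_num, by module⟩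
  refine hβ0 (funext fun i => ?_)
  have h := congrFun heq i
  simp only [Pi.add_apply, Pi.smul_apply, smul_eq_mul, hext, add_eq_left, mul_eq_zero] at h
  exact h.resolve_left (by positivity)

/-- At least three vectors of the unit ball of a normed plane summing to zero include three
whose sum lies in the unit ball. -/
lemma exists_card_eq_three_norm_sum_le_one_of_sum_eq_zero
    {E ι : Type*} [NormedAddCommGroup E] [NormedSpace ℝ E] [Fintype ι]
    (hdim : Module.finrank ℝ E = 2) (v : ι → E) (hv : ∀ i, ‖v i‖ ≤ 1)
    (hcard : 3 ≤ Fintype.card ι) (hsum : ∑ i, v i = 0) :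
    ∃ T : Finset ι, T.card = 3 ∧ ‖∑ i ∈ T, v i‖ ≤ 1 := by
  classical
  have : FiniteDimensional ℝ E := Module.finite_of_finrank_eq_succ hdim
  let L : (ι → ℝ) →ₗ[ℝ] ℝ × E :=
    (Fintype.linearCombination ℝ fun _ => (1 : ℝ)).prod (Fintype.linearCombination ℝ v)
  have hL (a : ι → ℝ) : L a = (∑ i, a i, ∑ i, a i • v i) := by
    simp [L, Fintype.linearCombination_apply]
  have hcompact : IsCompact (Set.Icc (0 : ι → ℝ) 1 ∩ L ⁻¹' {((3 : ℝ), (0 : E))}) :=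
    isCompact_Icc.inter_right (isClosed_singleton.preimage L.continuous_of_finiteDimensional)
  have hN : (3 : ℝ) ≤ Fintype.card ι := by exact_mod_cast hcard
  have hN0 : (0 : ℝ) < Fintype.card ι := by linarith
  obtain ⟨a, ha⟩ := hcompact.extremePoints_nonempty ⟨fun _ => 3 / Fintype.card ι,
    ⟨fun _ => by simp only [Pi.zero_apply]; positivity, fun _ => (div_le_one hN0).2 hN⟩, by
      simp only [Set.mem_preimage, hL, Set.mem_singleton_iff, ← Finset.smul_sum, hsum]
      simp [mul_div_cancel₀, hN0.ne']⟩
  have hF3 := card_fractional_le_finrank_of_mem_extremePoints L _ ha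
  obtain ⟨⟨ha0, ha1⟩, haL⟩ := ha.1
  rw [Module.finrank_prod, Module.finrank_self, hdim] at hF3
  rw [Set.mem_preimage, hL, Set.mem_singleton_iff, Prod.mk.injEq] at haL
  obtain ⟨ha3, hav⟩ := haL
  set F := Finset.univ.filter fun i => 0 < a i ∧ a i < 1 with hF
  set O := Finset.univ.filter fun i => a i = 1 with hO
  have hdisj : Disjoint O F := Finset.disjoint_left.2 fun i hi hi' => by
    simp only [hO, hF, Finset.mem_filter] at hi hi'
    linarith [hi'.2.2, hi.2]
  have hout : ∀ i ∉ O ∪ F, a i = 0 := fun i hi => by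
    simp only [hO, hF, Finset.mem_union, Finset.mem_filter, Finset.mem_univ, true_and,
      not_or, not_and, not_lt] at hi
    have h0 : 0 ≤ a i := ha0 i
    have h1 : a i ≤ 1 := ha1 i
    by_contra hne
    exact hi.1 (le_antisymm h1 (hi.2 (lt_of_le_of_ne h0 (Ne.symm hne))))
  have hO1 : ∀ i ∈ O, a i = 1 := fun i hi => (Finset.mem_filter.1 hi).2
  have hFpos : ∀ i ∈ F, 0 < a i := fun i hi => (Finset.mem_filter.1 hi).2.1
  have hFlt : ∀ i ∈ F, a i < 1 := fun i hi => (Finset.mem_filter.1 hi).2.2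
  have hcount : (O.card : ℝ) + ∑ i ∈ F, a i = 3 := by
    rw [← ha3, ← Finset.sum_subset (Finset.subset_univ (O ∪ F)) fun i _ hi => hout i hi,
      Finset.sum_union hdisj, Finset.sum_congr rfl hO1]
    simp
  have hvec : ∑ i ∈ O, v i + ∑ i ∈ F, a i • v i = 0 := by
    rw [← hav, ← Finset.sum_subset (Finset.subset_univ (O ∪ F)) fun i _ hi => by
      rw [hout i hi, zero_smul], Finset.sum_union hdisj]
    congr 1
    exact Finset.sum_congr rfl fun i hi => by rw [hO1 i hi, one_smul]
  rcases F.eq_empty_or_nonempty with hFe | hFne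
  · rw [hFe] at hcount hvec
    simp only [Finset.sum_empty, add_zero] at hcount hvec
    exact ⟨O, by exact_mod_cast hcount, by simp [hvec]⟩
  have hpos : 0 < ∑ i ∈ F, a i := Finset.sum_pos hFpos hFne
  have hlt : ∑ i ∈ F, a i < F.card := by
    simpa using Finset.sum_lt_sum_of_nonempty hFne hFlt
  have hF3' : (F.card : ℝ) ≤ 3 := by exact_mod_cast hF3
  have hO3 : O.card < 3 := by
    have : (O.card : ℝ) < 3 := by linarith
    exact_mod_cast this
  have hO0 : 0 < O.card := by
    have : (0 : ℝ) < O.card := by linarith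
    exact_mod_cast this
  obtain hO' | hO' : O.card = 2 ∨ O.card = 1 := by omega
  · rw [hO'] at hcount
    obtain ⟨i, hi, hnorm⟩ := exists_norm_sub_sum_smul_le_one hdim F v (fun i _ => hv i) a
      (fun i hi => (hFpos i hi).le) (by push_cast at hcount; linarith)
    have hiO : i ∉ O := fun h => Finset.disjoint_left.1 hdisj h hi
    refine ⟨insert i O, by rw [Finset.card_insert_of_notMem hiO, hO'], ?_⟩
    rwa [Finset.sum_insert hiO, eq_neg_of_add_eq_zero_left hvec, ← sub_eq_add_neg]
  · rw [hO'] at hcount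
    have hFcard : F.card = 3 := by
      have : (2 : ℝ) < F.card := by push_cast at hcount; linarith
      have : 2 < F.card := by exact_mod_cast this
      omega
    obtain ⟨i, hi, hnorm⟩ := exists_norm_sub_sum_smul_le_one hdim F v (fun i _ => hv i)
      (fun i => 1 - a i) (fun i hi => by linarith [hFlt i hi]) (by
        simp only [Finset.sum_sub_distrib, Finset.sum_const, hFcard]
        push_cast at hcount
        norm_num
        linarith)
    have hdisj' : Disjoint O (F.erase i) := hdisj.mono_right (Finset.erase_subset _ _)
    refine ⟨O ∪ F.erase i, ?_, ?_⟩
    · rw [Finset.card_union_of_disjoint hdisj', Finset.card_erase_of_mem hi, hO', hFcard]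
    · have h1 := Finset.add_sum_erase F v hi
      have h2 : ∑ j ∈ F, (1 - a j) • v j = ∑ j ∈ F, v j - ∑ j ∈ F, a j • v j := by
        simp only [sub_smul, one_smul, Finset.sum_sub_distrib]
      rw [Finset.sum_union hdisj', eq_neg_of_add_eq_zero_left hvec]
      rwa [h2, ← h1, norm_sub_rev, add_sub_assoc, add_sub_cancel_left, sub_eq_neg_add] at hnorm

/-- If at least two vectors of the unit ball of a normed plane have their sum in the unit ball,
then this also holds for some three of them or for all but two of them. -/
lemma exists_subset_norm_sum_le_one
    {E ι : Type*} [NormedAddCommGroup E] [NormedSpace ℝ E]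
    (hdim : Module.finrank ℝ E = 2) (v : ι → E) (hv : ∀ i, ‖v i‖ ≤ 1)
    (S : Finset ι) (hcard : 2 ≤ S.card) (hS : ‖∑ i ∈ S, v i‖ ≤ 1) :
    ∃ T ⊆ S, (T.card = 3 ∨ T.card + 2 = S.card) ∧ ‖∑ i ∈ T, v i‖ ≤ 1 := by
  classical
  let u : Option S → E := fun o => o.elim (-∑ i ∈ S, v i) fun i => v i
  obtain ⟨T, hT, hTn⟩ := exists_card_eq_three_norm_sum_le_one_of_sum_eq_zero hdim u
    (by rintro (_ | i); exacts [by simpa [u] using hS, hv i]) (by simp; omega)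
    (by
      rw [Fintype.sum_option, Finset.univ_eq_attach]
      simp only [u, Option.elim, Finset.sum_attach S v, neg_add_cancel])
  set R : Finset ι := T.eraseNone.map (Function.Embedding.subtype _) with hR
  have hRS : R ⊆ S := by
    intro i hi
    obtain ⟨j, -, rfl⟩ := Finset.mem_map.1 hi
    exact j.2
  have hRsum : ∑ i ∈ R, v i = ∑ o ∈ T.erase none, u o := by
    rw [← Finset.map_some_eraseNone, Finset.sum_map, Finset.sum_map]
    rfl
  have hRcard : R.card = (T.erase none).card := by
    rw [← Finset.map_some_eraseNone, Finset.card_map, Finset.card_map]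
  by_cases hnone : none ∈ T
  · rw [Finset.card_erase_of_mem hnone, hT] at hRcard
    refine ⟨S \ R, Finset.sdiff_subset, Or.inr ?_, ?_⟩
    · rw [Finset.card_sdiff_of_subset hRS, hRcard]
      omega
    · rw [← Finset.add_sum_erase T u hnone, ← hRsum] at hTn
      simpa [u, ← Finset.sum_sdiff hRS (f := v)] using hTn
  · rw [Finset.erase_eq_of_notMem hnone] at hRcard hRsum
    exact ⟨R, hRS, Or.inl (hRcard.trans hT), hRsum ▸ hTn⟩

/-- Corollary: if `n ≥ 5`, the `v i` lie in the closed unit ball of a normed plane,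
`k` is odd with `3 < k ≤ n`, and every 3-sum has norm greater than 1, then every
`k`-sum has norm greater than 1. -/
theorem k_sum_norm_gt_one_of_three_sums
    {E : Type*} [NormedAddCommGroup E] [NormedSpace ℝ E]
    (hdim : Module.finrank ℝ E = 2)
    {n : ℕ} (hn : 5 ≤ n)
    (v : Fin n → E) (hv : ∀ i, ‖v i‖ ≤ 1)
    {k : ℕ} (hk : Odd k) (hk3 : 3 < k) (hkn : k ≤ n)
    (h3 : ∀ S : Finset (Fin n), S.card = 3 → 1 < ‖∑ i ∈ S, v i‖) :
    ∀ S : Finset (Fin n), S.card = k → 1 < ‖∑ i ∈ S, v i‖ := by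
  intro S hS
  induction k using Nat.strong_induction_on generalizing S with
  | h k ih =>
    by_contra! hnorm
    obtain ⟨T, hTS, hT, hTn⟩ := exists_subset_norm_sum_le_one hdim v hv S (by omega) hnorm
    refine hTn.not_gt ?_
    by_cases hT3 : T.card = 3
    · exact h3 T hT3
    · have hTk : T.card + 2 = k := hS ▸ hT.resolve_left hT3
      obtain ⟨m, hm⟩ := hk
      exact ih T.card (by omega) ⟨m - 1, by omega⟩ (by omega) (by omega) T rfl
end

section
/- Let a, b, c be vectors in E with ‖a‖ = ‖b‖ = ‖c‖ = 1, and let Δ denote the convex hull of {a, b, c}. Then 0 ∈ Δ if and only if a + b + c ∈ Δ. -/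
/-- A point lies in the convex hull of three points iff it is a convex combination of them. -/
theorem mem_convexHull_triple_iff {E : Type*} [AddCommGroup E] [Module ℝ E] {a b c x : E} :
    x ∈ convexHull ℝ {a, b, c} ↔
      ∃ α β γ : ℝ, 0 ≤ α ∧ 0 ≤ β ∧ 0 ≤ γ ∧ α + β + γ = 1 ∧ α • a + β • b + γ • c = x := by
  constructor
  · intro hx
    rw [convexHull_insert (Set.insert_nonempty _ _), convexHull_pair, mem_convexJoin] at hx
    obtain ⟨y, rfl, z, ⟨p, q, hp, hq, hpq, rfl⟩, s, t, hs, ht, hst, rfl⟩ := hx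
    refine ⟨s, t * p, t * q, hs, mul_nonneg ht hp, mul_nonneg ht hq, ?_, by module⟩
    linear_combination hst + t * hpq
  · rintro ⟨α, β, γ, hα, hβ, hγ, hsum, rfl⟩
    have hmem := (convex_convexHull ℝ {a, b, c}).sum_mem (t := Finset.univ)
      (w := ![α, β, γ]) (z := ![a, b, c])
      (by intro i _; fin_cases i <;> simpa)
      (by simpa [Fin.sum_univ_three] using hsum)
      (by intro i _; apply subset_convexHull; fin_cases i <;> simp)
    simpa [Fin.sum_univ_three] using hmem

/-- In a vanishing nonnegative combination of three unit vectors, each coefficient is at most the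
sum of the other two. -/
theorem coeff_le_add_of_combination_eq_zero {E : Type*} [NormedAddCommGroup E] [NormedSpace ℝ E]
    {a b c : E} (ha : ‖a‖ = 1) (hb : ‖b‖ = 1) (hc : ‖c‖ = 1) {α β γ : ℝ}
    (hα : 0 ≤ α) (hβ : 0 ≤ β) (hγ : 0 ≤ γ) (h : α • a + β • b + γ • c = 0) :
    α ≤ β + γ := by
  have hneg : α • a = -(β • b + γ • c) := by
    rw [eq_neg_iff_add_eq_zero, ← add_assoc, h]
  calc α = ‖α • a‖ := by rw [norm_smul_of_nonneg hα, ha, mul_one]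
    _ = ‖β • b + γ • c‖ := by rw [hneg, norm_neg]
    _ ≤ ‖β • b‖ + ‖γ • c‖ := norm_add_le _ _
    _ = β + γ := by rw [norm_smul_of_nonneg hβ, norm_smul_of_nonneg hγ, hb, hc, mul_one, mul_one]

/-- Lemma 1: for unit vectors `a, b, c` in a normed plane and
`Δ = convexHull ℝ {a, b, c}`, one has `0 ∈ Δ` iff `a + b + c ∈ Δ`. -/
theorem zero_mem_triangle_iff_sum_mem
    {E : Type*} [NormedAddCommGroup E] [NormedSpace ℝ E]
    (hdim : Module.finrank ℝ E = 2)
    {a b c : E} (ha : ‖a‖ = 1) (hb : ‖b‖ = 1) (hc : ‖c‖ = 1) :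
    (0 : E) ∈ convexHull ℝ {a, b, c} ↔ a + b + c ∈ convexHull ℝ {a, b, c} := by
  rw [mem_convexHull_triple_iff, mem_convexHull_triple_iff]
  constructor
  · rintro ⟨α, β, γ, hα, hβ, hγ, hsum, h⟩
    have h₁ := coeff_le_add_of_combination_eq_zero ha hb hc hα hβ hγ h
    have h₂ := coeff_le_add_of_combination_eq_zero hb hc ha hβ hγ hα (by rw [← h]; abel)
    have h₃ := coeff_le_add_of_combination_eq_zero hc ha hb hγ hα hβ (by rw [← h]; abel)
    refine ⟨1 - 2 * α, 1 - 2 * β, 1 - 2 * γ, by linarith, by linarith, by linarith,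
      by linarith, ?_⟩
    linear_combination (norm := module) (-2 : ℝ) • h
  · rintro ⟨α, β, γ, hα, hβ, hγ, hsum, h⟩
    refine ⟨(1 - α) / 2, (1 - β) / 2, (1 - γ) / 2, by linarith, by linarith, by linarith,
      by linarith, ?_⟩
    linear_combination (norm := module) (-1 / 2 : ℝ) • h
end

section
/- Let z_1, …, z_6 be vectors in E with ‖z_i‖ ≤ 1 for every i and z_1 + z_2 + ⋯ + z_6 = 0. Then there exist pairwise distinct indices i, j, k ∈ {1,…,6} with ‖z_i + z_j + z_k‖ ≤ 1. -/
section Plane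

variable {E : Type*} [NormedAddCommGroup E] [NormedSpace ℝ E]

lemma norm_convex_comb_le_one {a b : ℝ} {x y : E} (ha : 0 ≤ a) (hb : 0 ≤ b) (hab : a + b = 1)
    (hx : ‖x‖ ≤ 1) (hy : ‖y‖ ≤ 1) : ‖a • x + b • y‖ ≤ 1 := by
  have := convex_closedBall (0 : E) 1 (by simpa using hx) (by simpa using hy) ha hb hab
  simpa using this

/-- If the chord `[m - p/2, m + p/2]` is the highest chord of the unit ball (with respect to `f`)
that is a translate of `[-p/2, p/2]`, then subtracting `p` from a point of the ball lying beyond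
the line through `p/2` in direction `m` stays in the ball. -/
lemma norm_sub_le_one_of_maximal_chord {p m : E} {f : E →ₗ[ℝ] ℝ} (hfp : f p = 0) (hfm : 0 < f m)
    (hm₁ : ‖m + (1 / 2 : ℝ) • p‖ ≤ 1) (hm₂ : ‖m - (1 / 2 : ℝ) • p‖ ≤ 1)
    (hmax : ∀ y, ‖y + (1 / 2 : ℝ) • p‖ ≤ 1 → ‖y - (1 / 2 : ℝ) • p‖ ≤ 1 → f y ≤ f m)
    {a b : ℝ} (ha : 1 / 2 < a) (hb : 0 ≤ b) (hx : ‖a • p + b • m‖ ≤ 1) :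
    ‖a • p + b • m - p‖ ≤ 1 := by
  rcases le_or_gt b 1 with hb1 | hb1
  · have hm₃ : ‖-(m + (1 / 2 : ℝ) • p)‖ ≤ 1 := by rwa [norm_neg]
    have hy := norm_convex_comb_le_one (a := (1 + b) / 2) (b := (1 - b) / 2) (by linarith)
      (by linarith) (by ring) hm₂ hm₃
    have hd : 0 < 2 * a + 1 := by linarith
    have key := norm_convex_comb_le_one (a := (2 * a - 1) / (2 * a + 1)) (b := 2 / (2 * a + 1))
      (div_nonneg (by linarith) hd.le) (by positivity) (by field_simp; ring) hx hy
    convert key using 2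
    match_scalars <;> field_simp <;> ring
  · exfalso
    have hd : 0 < 2 * a + b := by linarith
    have hm₃ : ‖-(m - (1 / 2 : ℝ) • p)‖ ≤ 1 := by rwa [norm_neg]
    have h₁ := norm_convex_comb_le_one (a := (b + 1) / (2 * a + b)) (b := (2 * a - 1) / (2 * a + b))
      (by positivity) (div_nonneg (by linarith) hd.le) (by field_simp; ring) hm₂ hx
    have h₂ := norm_convex_comb_le_one (a := (2 * a + 1) / (2 * a + b)) (b := (b - 1) / (2 * a + b))
      (div_nonneg (by linarith) hd.le) (div_nonneg (by linarith) hd.le) (by field_simp; ring) hx hm₃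
    have h := hmax (((b + 1) / (2 * a + b)) • (m - (1 / 2 : ℝ) • p)
        + ((2 * a - 1) / (2 * a + b)) • (a • p + b • m) + (1 / 2 : ℝ) • p)
      (by
        convert h₂ using 2
        match_scalars <;> field_simp <;> ring)
      (by rwa [add_sub_cancel_right])
    simp only [map_add, map_sub, map_smul, hfp, smul_eq_mul, mul_zero, sub_zero, add_zero,
      zero_add] at h
    have hε : 0 < (2 * a - 1) / (2 * a + b) := div_pos (by linarith) hd
    have hsum : (b + 1) / (2 * a + b) = 1 - (2 * a - 1) / (2 * a + b) := by field_simp; ring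
    rw [hsum] at h
    nlinarith [mul_pos (mul_pos hε hfm) (sub_pos.2 hb1)]

/-- In a normed plane, for every nonzero `p` of norm at most one some line through `p / 2` separates
`p` from all points of the unit ball at distance greater than one from `p`. -/
lemma exists_dual_separating (hdim : Module.finrank ℝ E = 2) {p : E} (hp0 : p ≠ 0)
    (hp : ‖p‖ ≤ 1) :
    ∃ g : E →ₗ[ℝ] ℝ, g p = 1 ∧ ∀ x, ‖x‖ ≤ 1 → 1 / 2 < g x → ‖x - p‖ ≤ 1 := by
  have : FiniteDimensional ℝ E := .of_finrank_pos (by omega)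
  have : ProperSpace E := FiniteDimensional.proper ℝ E
  have hspan : Module.finrank ℝ (Submodule.span ℝ {p}) = 1 := finrank_span_singleton hp0
  have hlt : Submodule.span ℝ {p} < ⊤ := by
    rw [lt_top_iff_ne_top]
    intro h
    rw [h, finrank_top] at hspan
    omega
  obtain ⟨f, hf0, hf⟩ := Submodule.exists_le_ker_of_lt_top _ hlt
  have hfp : f p = 0 := hf (Submodule.mem_span_singleton_self p)
  have hker : ∀ x, f x = 0 → ∃ a : ℝ, a • p = x := by
    have h1 : Module.finrank ℝ (LinearMap.ker f) < Module.finrank ℝ E := by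
      apply Submodule.finrank_lt
      rwa [Ne, LinearMap.ker_eq_top]
    have h2 := Submodule.eq_of_le_of_finrank_le hf (by omega)
    intro x hx
    exact Submodule.mem_span_singleton.1 (h2 ▸ (LinearMap.mem_ker.2 hx))
  obtain ⟨g₀, hg₀⟩ : ∃ g₀ : E →ₗ[ℝ] ℝ, g₀ p = 1 := by
    obtain ⟨g, hg⟩ := SeparatingDual.exists_eq_one (R := ℝ) hp0
    exact ⟨g, hg⟩
  have hhalf : ‖(1 / 2 : ℝ) • p‖ ≤ 1 / 2 := by
    rw [norm_smul]; norm_num; linarith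
  have hfc : Continuous f := f.continuous_of_finiteDimensional
  let K : Set E := Metric.closedBall (-((1 / 2 : ℝ) • p)) 1 ∩ Metric.closedBall ((1 / 2 : ℝ) • p) 1
  have hmemK : ∀ y, y ∈ K ↔ ‖y + (1 / 2 : ℝ) • p‖ ≤ 1 ∧ ‖y - (1 / 2 : ℝ) • p‖ ≤ 1 := by
    intro y
    simp [K, dist_eq_norm]
  have hK : IsCompact K := (isCompact_closedBall _ _).inter (isCompact_closedBall _ _)
  have hball : ∀ y : E, ‖y‖ ≤ 1 / 2 → y ∈ K := fun y hy ↦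
    (hmemK y).2 ⟨(norm_add_le _ _).trans (by linarith), (norm_sub_le _ _).trans (by linarith)⟩
  obtain ⟨m, hmK, hmax⟩ := hK.exists_isMaxOn ⟨0, hball 0 (by simp)⟩ hfc.continuousOn
  have hfm : 0 < f m := by
    obtain ⟨v, hv⟩ : ∃ v, f v ≠ 0 := by
      by_contra! h
      exact hf0 (LinearMap.ext h)
    have hv0 : 0 < ‖v‖ := norm_pos_iff.2 fun h ↦ hv (by simp [h])
    have hle := hmax (hball ((f v / |f v| * (1 / (2 * ‖v‖))) • v) (by
      rw [norm_smul, norm_mul, norm_div, Real.norm_eq_abs, Real.norm_eq_abs, abs_abs,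
        div_self (abs_pos.2 hv).ne', Real.norm_of_nonneg (by positivity)]
      apply le_of_eq
      field_simp))
    refine lt_of_lt_of_le ?_ hle
    have hv2 : 0 < |f v| := abs_pos.2 hv
    have hpos : 0 < f v * f v := mul_self_pos.2 hv
    simp only [map_smul, smul_eq_mul]
    have : f v / |f v| * (1 / (2 * ‖v‖)) * f v = f v * f v / (|f v| * (2 * ‖v‖)) := by
      field_simp
    rw [this]
    positivity
  obtain ⟨hm₁, hm₂⟩ := (hmemK m).1 hmK
  have hmax' : ∀ y, ‖y + (1 / 2 : ℝ) • p‖ ≤ 1 → ‖y - (1 / 2 : ℝ) • p‖ ≤ 1 → f y ≤ f m :=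
    fun y h₁ h₂ ↦ hmax ((hmemK y).2 ⟨h₁, h₂⟩)
  refine ⟨g₀ - (g₀ m / f m) • f, by simp [hfp, hg₀], fun x hx hgx ↦ ?_⟩
  obtain ⟨a, b, rfl⟩ : ∃ a b : ℝ, x = a • p + b • m := by
    obtain ⟨a, ha⟩ := hker (x - (f x / f m) • m) (by simp [hfm.ne'])
    exact ⟨a, f x / f m, by rw [ha]; abel⟩
  have hga : 1 / 2 < a := by
    have hgm : g₀ m / f m * (b * f m) = b * g₀ m := by field_simp
    simpa [hfp, hg₀, hgm] using hgx
  rcases le_total 0 b with hb | hb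
  · exact norm_sub_le_one_of_maximal_chord hfp hfm hm₁ hm₂ hmax' hga hb hx
  · have h := norm_sub_le_one_of_maximal_chord (p := p) (m := -m) (f := -f) (a := a) (b := -b)
      (by simp [hfp]) (by simpa using hfm)
      (by rwa [neg_add_eq_sub, norm_sub_rev])
      (by rwa [← neg_add', norm_neg])
      (fun y h₁ h₂ ↦ by
        have := hmax' (-y) (by rwa [neg_add_eq_sub, norm_sub_rev])
          (by rwa [← neg_add', norm_neg])
        simpa using this)
      hga (by linarith) (by simpa using hx)
    simpa using h

/-- In a normed plane, every convex combination of points of the unit ball is at distance at most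
one from one of these points. -/
lemma exists_norm_sub_convex_comb_le_one (hdim : Module.finrank ℝ E = 2) {ι : Type*}
    (s : Finset ι) (z : ι → E) (w : ι → ℝ) (hz : ∀ i ∈ s, ‖z i‖ ≤ 1) (hw : ∀ i ∈ s, 0 ≤ w i)
    (hw1 : ∑ i ∈ s, w i = 1) : ∃ i ∈ s, ‖z i - ∑ j ∈ s, w j • z j‖ ≤ 1 := by
  set p := ∑ j ∈ s, w j • z j with hp
  have hpn : ‖p‖ ≤ 1 := by
    have := (convex_closedBall (0 : E) 1).sum_mem hw hw1 (z := z) (by simpa using hz)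
    simpa using this
  by_cases hp0 : p = 0
  · obtain ⟨i, hi⟩ : s.Nonempty := by
      rw [Finset.nonempty_iff_ne_empty]
      rintro rfl
      simp at hw1
    exact ⟨i, hi, by simpa [hp0] using hz i hi⟩
  obtain ⟨g, hgp, hg⟩ := exists_dual_separating hdim hp0 hpn
  by_contra! h
  have hgz : ∀ i ∈ s, g (z i) ≤ 1 / 2 := fun i hi ↦ by
    by_contra! hi'
    exact (h i hi).not_ge (hg _ (hz i hi) hi')
  have : g p ≤ 1 / 2 := calc
    g p = ∑ j ∈ s, w j * g (z j) := by rw [hp]; simp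
    _ ≤ ∑ j ∈ s, w j * (1 / 2) :=
      Finset.sum_le_sum fun j hj ↦ mul_le_mul_of_nonneg_left (hgz j hj) (hw j hj)
    _ = 1 / 2 := by rw [← Finset.sum_mul, hw1, one_mul]
  linarith

/-- Six vectors in a plane that sum to zero admit coefficients in `[0, 1]` with sum `3` and
vanishing linear combination, at most three of which are strictly between `0` and `1`. -/
lemma exists_weights_card_fractional_le (hdim : Module.finrank ℝ E = 2) (z : Fin 6 → E)
    (hsum : ∑ i, z i = 0) :
    ∃ α : Fin 6 → ℝ, (∀ i, 0 ≤ α i ∧ α i ≤ 1) ∧ ∑ i, α i = 3 ∧ ∑ i, α i • z i = 0 ∧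
      (Finset.univ.filter fun i ↦ 0 < α i ∧ α i < 1).card ≤ 3 := by
  have : FiniteDimensional ℝ E := .of_finrank_pos (by omega)
  let L : (Fin 6 → ℝ) →ₗ[ℝ] E × ℝ := (Fintype.linearCombination ℝ z).prod
    (Fintype.linearCombination ℝ fun _ ↦ (1 : ℝ))
  have hL : ∀ α, L α = (∑ i, α i • z i, ∑ i, α i) := fun α ↦ by
    simp [L, Fintype.linearCombination_apply]
  let P : Set (Fin 6 → ℝ) := Set.Icc 0 1 ∩ L ⁻¹' {(0, 3)}
  have hPc : IsCompact P := isCompact_Icc.inter_right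
    (isClosed_singleton.preimage L.continuous_of_finiteDimensional)
  have hPn : P.Nonempty := by
    refine ⟨fun _ ↦ 1 / 2, ⟨fun i ↦ ?_, fun i ↦ ?_⟩, ?_⟩
    · norm_num
    · norm_num
    · simp only [Set.mem_preimage, hL, ← Finset.smul_sum, hsum, Set.mem_singleton_iff]
      norm_num
  obtain ⟨α, hα⟩ := hPc.extremePoints_nonempty hPn
  have hαP : α ∈ P := hα.1
  have hαL := hαP.2
  simp only [Set.mem_preimage, hL, Set.mem_singleton_iff, Prod.mk.injEq] at hαL
  refine ⟨α, fun i ↦ ⟨hαP.1.1 i, hαP.1.2 i⟩, hαL.2, hαL.1, ?_⟩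
  set F := Finset.univ.filter fun i ↦ 0 < α i ∧ α i < 1 with hF
  by_contra! hcard
  let R : (F → ℝ) →ₗ[ℝ] (Fin 6 → ℝ) := Function.ExtendByZero.linearMap ℝ Subtype.val
  have hRinj : Function.Injective R := fun x y h ↦ by
    ext i
    have := congrFun h i
    simpa [R, Subtype.val_injective.extend_apply] using this
  obtain ⟨β, hβ, hβ0⟩ := (Submodule.ne_bot_iff _).1
    (LinearMap.ker_ne_bot_of_finrank_lt (f := L ∘ₗ R) (by simp [hdim]; omega))
  have hγ0 : R β ≠ 0 := fun h ↦ hβ0 (hRinj (by simpa using h))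
  have hγL : L (R β) = 0 := hβ
  have hγF : ∀ i, ¬ (0 < α i ∧ α i < 1) → R β i = 0 := fun i hi ↦ by
    have : ¬ ∃ a : F, (a : Fin 6) = i := by
      rintro ⟨a, rfl⟩
      exact hi (Finset.mem_filter.1 a.2).2
    simp [R, Function.extend_apply' _ _ _ this]
  generalize R β = γ at *
  obtain ⟨ε, hε, hεi⟩ : ∃ ε > 0, ∀ i, |ε * γ i| ≤ α i ∧ |ε * γ i| ≤ 1 - α i := by
    have hev : ∀ i, ∀ᶠ ε : ℝ in nhdsWithin 0 (Set.Ioi 0),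
        |ε * γ i| ≤ α i ∧ |ε * γ i| ≤ 1 - α i := fun i ↦ by
      by_cases hi : 0 < α i ∧ α i < 1
      · have ht : Filter.Tendsto (fun ε : ℝ ↦ |ε * γ i|) (nhdsWithin 0 (Set.Ioi 0)) (nhds 0) := by
          have : Continuous fun ε : ℝ ↦ |ε * γ i| := by fun_prop
          simpa using (this.tendsto 0).mono_left nhdsWithin_le_nhds
        filter_upwards [ht.eventually_lt_const hi.1, ht.eventually_lt_const (sub_pos.2 hi.2)]
          with ε h₁ h₂ using ⟨h₁.le, h₂.le⟩
      · refine .of_forall fun ε ↦ ?_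
        simpa [hγF i hi] using ⟨hαP.1.1 i, hαP.1.2 i⟩
    obtain ⟨ε, h₁, h₂⟩ := ((Filter.eventually_all.2 hev).and self_mem_nhdsWithin).exists
    exact ⟨ε, h₂, h₁⟩
  have hmem : ∀ σ : ℝ, |σ| = 1 → α + (σ * ε) • γ ∈ P := fun σ hσ ↦ by
    have hb : ∀ i, |σ * ε * γ i| = |ε * γ i| := fun i ↦ by rw [mul_assoc, abs_mul, hσ, one_mul]
    refine ⟨⟨fun i ↦ ?_, fun i ↦ ?_⟩, ?_⟩
    · have := neg_abs_le (σ * ε * γ i)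
      have := (hεi i).1
      simp only [Pi.zero_apply, Pi.add_apply, Pi.smul_apply, smul_eq_mul]
      linarith [hb i]
    · have := le_abs_self (σ * ε * γ i)
      have := (hεi i).2
      simp only [Pi.one_apply, Pi.add_apply, Pi.smul_apply, smul_eq_mul]
      linarith [hb i]
    · have : L α = (0, 3) := hαP.2
      simp [hγL, this]
  have hseg : α ∈ openSegment ℝ (α + (1 * ε) • γ) (α + (-1 * ε) • γ) := by
    refine ⟨1 / 2, 1 / 2, by norm_num, by norm_num, by norm_num, ?_⟩
    module
  have heq := hα.2 (hmem 1 (by simp)) (hmem (-1) (by simp)) hseg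
  have : ε • γ = 0 := by simpa using heq
  exact hγ0 ((smul_eq_zero.1 this).resolve_left hε.ne')

lemma exists_three_sum_of_two_ones (hdim : Module.finrank ℝ E = 2) (z : Fin 6 → E)
    (hz : ∀ i, ‖z i‖ ≤ 1) (α : Fin 6 → ℝ) (hα : ∀ i, 0 ≤ α i) (hα3 : ∑ i, α i = 3)
    (hαz : ∑ i, α i • z i = 0) {i j : Fin 6} (hij : i ≠ j) (hi : α i = 1) (hj : α j = 1) :
    ∃ i j k : Fin 6, i ≠ j ∧ i ≠ k ∧ j ≠ k ∧ ‖z i + z j + z k‖ ≤ 1 := by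
  have h3 := Finset.sum_add_sum_compl {i, j} α
  have h0 := Finset.sum_add_sum_compl {i, j} fun k ↦ α k • z k
  rw [Finset.sum_pair hij] at h3 h0
  obtain ⟨k, hk, hle⟩ := exists_norm_sub_convex_comb_le_one hdim ({i, j} : Finset (Fin 6))ᶜ z α
    (fun k _ ↦ hz k) (fun k _ ↦ hα k) (by linarith)
  simp only [Finset.mem_compl, Finset.mem_insert, Finset.mem_singleton, not_or] at hk
  refine ⟨i, j, k, hij, Ne.symm hk.1, Ne.symm hk.2, ?_⟩
  convert hle using 2
  rw [hαz, hi, hj, one_smul, one_smul] at h0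
  rw [← neg_eq_of_add_eq_zero_right h0]
  abel

end Plane

/-- Lemma 2: if six vectors of a normed plane lie in the closed unit ball and sum to
zero, then some 3-sum over distinct indices lies in the closed unit ball. -/
theorem exists_three_sum_in_ball
    {E : Type*} [NormedAddCommGroup E] [NormedSpace ℝ E]
    (hdim : Module.finrank ℝ E = 2)
    (z : Fin 6 → E) (hz : ∀ i, ‖z i‖ ≤ 1) (hsum : ∑ i, z i = 0) :
    ∃ i j k : Fin 6, i ≠ j ∧ i ≠ k ∧ j ≠ k ∧ ‖z i + z j + z k‖ ≤ 1 := by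
  obtain ⟨α, hα, hα3, hαz, hcard⟩ := exists_weights_card_fractional_le hdim z hsum
  have hcompl : ({0, 1} : Finset ℝ).card <
      (Finset.univ.filter fun i ↦ 0 < α i ∧ α i < 1)ᶜ.card := by
    rw [Finset.card_compl, Finset.card_pair zero_ne_one, Fintype.card_fin]
    omega
  have hmaps : ∀ i ∈ (Finset.univ.filter fun i ↦ 0 < α i ∧ α i < 1)ᶜ, α i ∈ ({0, 1} : Finset ℝ) :=
    fun i hi ↦ by
      simp only [Finset.mem_compl, Finset.mem_filter_univ, not_and, not_lt] at hi
      rw [Finset.mem_insert, Finset.mem_singleton]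
      rcases (hα i).1.eq_or_lt with h | h
      · exact .inl h.symm
      · exact .inr ((hα i).2.antisymm (hi h))
  obtain ⟨i, hi, j, -, hij, heq⟩ := Finset.exists_ne_map_eq_of_card_lt_of_maps_to hcompl hmaps
  have hi01 := hmaps i hi
  rw [Finset.mem_insert, Finset.mem_singleton] at hi01
  rcases hi01 with h | h
  · refine exists_three_sum_of_two_ones hdim z hz (fun k ↦ 1 - α k)
      (fun k ↦ sub_nonneg.2 (hα k).2) ?_ ?_ hij (by simp [h]) (by simp [← heq, h])
    · rw [Finset.sum_sub_distrib, hα3]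
      norm_num
    · simp only [sub_smul, one_smul, Finset.sum_sub_distrib, hαz, hsum, sub_zero]
  · exact exists_three_sum_of_two_ones hdim z hz α (fun k ↦ (hα k).1) hα3 hαz hij h (heq ▸ h)
end

section
/- Let z_1, …, z_6 be real numbers with z_1 + z_2 + ⋯ + z_6 = 0 and z_i ∈ [-1, 1] for every i. Then there are at least 12 distinct 3-element subsets S of {1,…,6} such that ∑_{i∈S} z_i ∈ [-1, 1]. -/
/-- A family of 3-element subsets of `Fin 6`, any two of which share exactly two elements, has at
most four members: either all members contain a common pair, or all lie in a common 4-set. -/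
theorem card_le_four_of_pairwise_card_inter_eq_two (F : Finset (Finset (Fin 6)))
    (h3 : ∀ S ∈ F, S.card = 3)
    (h2 : ∀ S ∈ F, ∀ T ∈ F, S ≠ T → (S ∩ T).card = 2) : F.card ≤ 4 := by
  rcases Nat.lt_or_ge 1 F.card with h1 | h1
  swap
  · lia
  obtain ⟨S, hS, T, hT, hST⟩ := Finset.one_lt_card.mp h1
  have hcap := h2 S hS T hT hST
  have hcup : (S ∪ T).card = 4 := by
    have := Finset.card_union_add_card_inter S T
    have := h3 S hS
    have := h3 T hT
    lia
  by_cases hall : ∀ U ∈ F, S ∩ T ⊆ U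
  · have hsub : F ⊆ (S ∩ T)ᶜ.image (fun x => insert x (S ∩ T)) := by
      intro U hU
      obtain ⟨x, hx, hxU⟩ := (Finset.covBy_iff_exists_insert).mp
        (Finset.covBy_iff_card_sdiff_eq_one.mpr
          ⟨hall U hU, by rw [Finset.card_sdiff_of_subset (hall U hU), h3 U hU, hcap]⟩)
      exact Finset.mem_image.mpr ⟨x, Finset.mem_compl.mpr hx, hxU⟩
    calc F.card ≤ _ := Finset.card_le_card hsub
      _ ≤ (S ∩ T)ᶜ.card := Finset.card_image_le
      _ = 4 := by rw [Finset.card_compl, hcap, Fintype.card_fin]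
  · push Not at hall
    obtain ⟨U, hU, hUcap⟩ := hall
    have subset_cup : ∀ V ∈ F, ¬ S ∩ T ⊆ V → V ⊆ S ∪ T ∧ (V ∩ (S ∩ T)).card ≤ 1 := by
      intro V hV hVcap
      have hVS : V ≠ S := by rintro rfl; exact hVcap Finset.inter_subset_left
      have hVT : V ≠ T := by rintro rfl; exact hVcap Finset.inter_subset_right
      have hlt : (V ∩ (S ∩ T)).card < (S ∩ T).card :=
        Finset.card_lt_card ⟨Finset.inter_subset_right,
          fun h => hVcap (h.trans Finset.inter_subset_left)⟩
      have hcount := Finset.card_union_add_card_inter (V ∩ S) (V ∩ T)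
      rw [← Finset.inter_union_distrib_left, ← Finset.inter_inter_distrib_left,
        h2 V hV S hS hVS, h2 V hV T hT hVT] at hcount
      refine ⟨?_, by lia⟩
      have := h3 V hV
      exact Finset.inter_eq_left.mp
        (Finset.eq_of_subset_of_card_le Finset.inter_subset_left (by lia))
    obtain ⟨hUcup, hUcard⟩ := subset_cup U hU hUcap
    have hsub : F ⊆ (S ∪ T).powersetCard 3 := by
      intro V hV
      refine Finset.mem_powersetCard.mpr ⟨?_, h3 V hV⟩
      by_cases hVcap : S ∩ T ⊆ V
      swap
      · exact (subset_cup V hV hVcap).1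
      by_contra hVcup
      have hUV : U ≠ V := by rintro rfl; exact hUcap hVcap
      have hlt : (V ∩ (S ∪ T)).card < V.card :=
        Finset.card_lt_card ⟨Finset.inter_subset_left,
          fun h => hVcup (h.trans Finset.inter_subset_right)⟩
      have heq : S ∩ T = V ∩ (S ∪ T) :=
        Finset.eq_of_subset_of_card_le
          (Finset.subset_inter hVcap
            (Finset.inter_subset_left.trans Finset.subset_union_left))
          (by have := h3 V hV; lia)
      have hle : (U ∩ V).card ≤ (U ∩ (S ∩ T)).card := by
        apply Finset.card_le_card
        rw [heq]
        intro x hx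
        have := Finset.mem_inter.mp hx
        simp only [Finset.mem_inter]
        exact ⟨this.1, this.2, hUcup this.1⟩
      have := h2 U hU V hV hUV
      lia
    calc F.card ≤ _ := Finset.card_le_card hsub
      _ = 4 := by rw [Finset.card_powersetCard, hcup]; rfl

theorem abs_sum_le_card {ι : Type*} (z : ι → ℝ) (hz : ∀ i, |z i| ≤ 1) (S : Finset ι) :
    |∑ i ∈ S, z i| ≤ S.card :=
  (Finset.abs_sum_le_sum_abs z S).trans <| by
    simpa using Finset.sum_le_card_nsmul S (fun i => |z i|) 1 fun i _ => hz i

theorem card_triples_one_lt_sum_le_four (z : Fin 6 → ℝ) (hz : ∀ i, |z i| ≤ 1)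
    (hsum : ∑ i, z i = 0) :
    (Finset.univ.filter
      (fun S : Finset (Fin 6) => S.card = 3 ∧ 1 < ∑ i ∈ S, z i)).card ≤ 4 := by
  apply card_le_four_of_pairwise_card_inter_eq_two
  · intro S hS
    exact (Finset.mem_filter.mp hS).2.1
  intro S hS T hT hST
  obtain ⟨hS3, hS1⟩ := (Finset.mem_filter.mp hS).2
  obtain ⟨hT3, hT1⟩ := (Finset.mem_filter.mp hT).2
  have hlt : (S ∩ T).card < 3 := by
    by_contra! h
    have hS' := Finset.eq_of_subset_of_card_le (Finset.inter_subset_left (s₁ := S) (s₂ := T))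
      (by lia)
    have hT' := Finset.eq_of_subset_of_card_le (Finset.inter_subset_right (s₁ := S) (s₂ := T))
      (by lia)
    exact hST (hS'.symm.trans hT')
  by_contra hne
  have hcard := Finset.card_union_add_card_inter S T
  have hcompl := Finset.card_add_card_compl (S ∪ T)
  rw [Fintype.card_fin] at hcompl
  have hcap : ((S ∩ T).card : ℝ) ≤ 1 := by
    exact_mod_cast (by lia : (S ∩ T).card ≤ 1)
  have hcup : ((S ∪ T)ᶜ.card : ℝ) ≤ 1 := by
    exact_mod_cast (by lia : (S ∪ T)ᶜ.card ≤ 1)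
  have hsplit := Finset.sum_union_inter (s₁ := S) (s₂ := T) (f := z)
  have htotal := Finset.sum_add_sum_compl (S ∪ T) z
  have h1 := (abs_le.mp (abs_sum_le_card z hz (S ∩ T))).2
  have h2 := (abs_le.mp (abs_sum_le_card z hz (S ∪ T)ᶜ)).1
  linarith

/-- Claim 1: if six real numbers in `[-1,1]` sum to zero, then at least 12 of the
3-element index subsets have their sum in `[-1,1]`. -/
theorem twelve_triples_in_interval
    (z : Fin 6 → ℝ) (hz : ∀ i, |z i| ≤ 1) (hsum : ∑ i, z i = 0) :
    12 ≤ (Finset.univ.filter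
      (fun S : Finset (Fin 6) => S.card = 3 ∧ |∑ i ∈ S, z i| ≤ 1)).card := by
  have hpos := card_triples_one_lt_sum_le_four z hz hsum
  have hneg := card_triples_one_lt_sum_le_four (fun i => -z i) (by simpa using hz)
    (by simpa using hsum)
  set G := Finset.univ.filter
    (fun S : Finset (Fin 6) => S.card = 3 ∧ |∑ i ∈ S, z i| ≤ 1)
  set P := Finset.univ.filter
    (fun S : Finset (Fin 6) => S.card = 3 ∧ 1 < ∑ i ∈ S, z i)
  set N := Finset.univ.filter
    (fun S : Finset (Fin 6) => S.card = 3 ∧ 1 < ∑ i ∈ S, -z i)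
  have hcover : (Finset.univ : Finset (Fin 6)).powersetCard 3 ⊆ G ∪ (P ∪ N) := by
    intro S hS
    have hS3 := (Finset.mem_powersetCard.mp hS).2
    simp only [G, P, N, Finset.mem_union, Finset.mem_filter, Finset.mem_univ, true_and, hS3,
      Finset.sum_neg_distrib, abs_le]
    by_contra! h
    linarith [h.1 (by linarith [h.2.2]), h.2.1]
  have htwenty : ((Finset.univ : Finset (Fin 6)).powersetCard 3).card = 20 := by
    rw [Finset.card_powersetCard, Finset.card_univ, Fintype.card_fin]
    rfl
  have h1 := Finset.card_le_card hcover
  have h2 := Finset.card_union_le G (P ∪ N)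
  have h3 := Finset.card_union_le P N
  lia
end

section
/- Let n be an odd integer with n ≥ 3 and let x_1 ≥ x_2 ≥ ⋯ ≥ x_n be real numbers (not necessarily ordered in the formal statement) with |x_i| ≤ 1 for every i. If for all pairwise distinct indices i, j, k one has |x_i + x_j + x_k| > 1, then |x_1 + x_2 + ⋯ + x_n| > 1. -/
/-- A sum over a finite set of even cardinality is nonnegative if all sums of two terms are. -/
theorem Finset.sum_nonneg_of_even_card_of_pairs {ι : Type*} [DecidableEq ι] (x : ι → ℝ)
    (s : Finset ι) (hs : Even s.card)
    (hpair : ∀ a ∈ s, ∀ b ∈ s, a ≠ b → 0 ≤ x a + x b) : 0 ≤ ∑ i ∈ s, x i := by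
  induction s using Finset.strongInduction with
  | H s ih =>
    rcases s.eq_empty_or_nonempty with rfl | hne
    · simp
    have hcard : 1 < s.card := by
      have := hne.card_pos
      obtain ⟨m, hm⟩ := hs
      omega
    obtain ⟨a, ha, b, hb, hab⟩ := Finset.one_lt_card.mp hcard
    have hb' : b ∈ s.erase a := Finset.mem_erase.mpr ⟨hab.symm, hb⟩
    have hsub : (s.erase a).erase b ⊆ s :=
      (Finset.erase_subset _ _).trans (Finset.erase_subset _ _)
    have hrest : 0 ≤ ∑ i ∈ (s.erase a).erase b, x i := by
      refine ih _ ((Finset.erase_ssubset hb').trans (Finset.erase_ssubset ha)) ?_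
        fun c hc d hd => hpair c (hsub hc) d (hsub hd)
      rw [Finset.card_erase_of_mem hb', Finset.card_erase_of_mem ha]
      obtain ⟨m, hm⟩ := hs
      exact ⟨m - 1, by omega⟩
    have hsum_a := Finset.add_sum_erase s x ha
    have hsum_b := Finset.add_sum_erase (s.erase a) x hb'
    linarith [hpair a ha b hb hab]

/-- If all sums of three terms lie outside `[-1, 1]` and one of them exceeds `1`, then the total
sum of an odd number of reals in `[-1, 1]` exceeds `1`. -/
theorem one_lt_sum_of_one_lt_triple {ι : Type*} [Fintype ι] [DecidableEq ι]
    (hodd : Odd (Fintype.card ι)) (x : ι → ℝ) (hx : ∀ i, |x i| ≤ 1)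
    (h3 : ∀ i j k : ι, i ≠ j → i ≠ k → j ≠ k → 1 < |x i + x j + x k|)
    {i j k : ι} (hij : i ≠ j) (hik : i ≠ k) (hjk : j ≠ k) (hpos : 1 < x i + x j + x k) :
    1 < ∑ l, x l := by
  have hexchange : ∀ a b c d : ι, a ≠ b → a ≠ d → b ≠ d →
      1 < x a + x b + x c → 1 < x a + x b + x d := by
    intro a b c d hab had hbd h
    have hc := abs_le.mp (hx c)
    have hd := abs_le.mp (hx d)
    rcases lt_abs.mp (h3 a b d hab had hbd) with h' | h' <;> linarith
  have hcard : ({i, j, k} : Finset ι).card = 3 := Finset.card_eq_three.mpr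
    ⟨i, j, k, hij, hik, hjk, rfl⟩
  have hcompl : 0 ≤ ∑ l ∈ ({i, j, k} : Finset ι)ᶜ, x l := by
    refine Finset.sum_nonneg_of_even_card_of_pairs x _ ?_ ?_
    · rw [Finset.card_compl, hcard]
      obtain ⟨m, hm⟩ := hodd
      exact ⟨m - 1, by omega⟩
    · intro a ha b hb hab
      simp only [Finset.mem_compl, Finset.mem_insert, Finset.mem_singleton, not_or] at ha hb
      have hija := hexchange i j k a hij (Ne.symm ha.1) (Ne.symm ha.2.1) hpos
      have hiab := hexchange i a j b (Ne.symm ha.1) (Ne.symm hb.1) hab (by linarith)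
      linarith [(abs_le.mp (hx i)).2]
  have htriple : ∑ l ∈ ({i, j, k} : Finset ι), x l = x i + x j + x k := by
    rw [Finset.sum_insert (by simp [hij, hik]), Finset.sum_pair hjk, add_assoc]
  linarith [Finset.sum_add_sum_compl ({i, j, k} : Finset ι) x]

/-- The one-dimensional case of the strict Helly-type theorem: if `n ≥ 3` is odd,
the reals `x i` lie in `[-1,1]`, and every 3-sum over distinct indices has absolute
value greater than 1, then the total sum has absolute value greater than 1. -/
theorem abs_sum_gt_one_of_three_sums
    {n : ℕ} (hn : 3 ≤ n) (hodd : Odd n)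
    (x : Fin n → ℝ) (hx : ∀ i, |x i| ≤ 1)
    (h3 : ∀ i j k : Fin n, i ≠ j → i ≠ k → j ≠ k → 1 < |x i + x j + x k|) :
    1 < |∑ i, x i| := by
  obtain ⟨i, j, k, hij, hik, hjk⟩ := Fintype.two_lt_card_iff.mp
    (by rw [Fintype.card_fin]; exact hn)
  have hodd' : Odd (Fintype.card (Fin n)) := by simpa using hodd
  rcases lt_abs.mp (h3 i j k hij hik hjk) with h | h
  · exact lt_abs.mpr (.inl (one_lt_sum_of_one_lt_triple hodd' x hx h3 hij hik hjk h))
  · refine lt_abs.mpr (.inr ?_)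
    rw [← Finset.sum_neg_distrib]
    refine one_lt_sum_of_one_lt_triple hodd' (fun l => -x l) (by simpa using hx) ?_
      hij hik hjk (by linarith)
    intro a b c hab hac hbc
    rw [← neg_add, ← neg_add, abs_neg]
    exact h3 a b c hab hac hbc
end

section
/- Let v_1, …, v_n be vectors in E with ‖v_i‖ = 1 for every i. Then one can choose signs ε_1, …, ε_n ∈ {1, -1} such that for every subset W ⊆ {1,…,n} of odd cardinality, ‖∑_{i∈W} ε_i v_i‖ ≥ 1. -/
/-- A finite set of odd size has a median: an element `w` such that a function whose values at
points on opposite sides of `w` have nonnegative sum has total at least its value at `w`. -/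
theorem Finset.exists_median_le_sum {ι : Type*} [DecidableEq ι] (t : ι → ℝ) (W : Finset ι)
    (hW : Odd W.card) :
    ∃ w ∈ W, ∀ g : ι → ℝ, (∀ a b, t a ≤ t w → t w ≤ t b → 0 ≤ g a + g b) →
      g w ≤ ∑ i ∈ W, g i := by
  obtain ⟨k, hk⟩ := hW
  induction k generalizing W with
  | zero =>
    obtain ⟨w, rfl⟩ := Finset.card_eq_one.1 hk
    exact ⟨w, by simp, fun g _ => by simp⟩
  | succ k ih =>
    obtain ⟨a, ha, hamin⟩ := W.exists_min_image t (Finset.card_pos.1 (by omega))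
    have hcard := Finset.card_erase_of_mem ha
    obtain ⟨b, hb, hbmax⟩ := (W.erase a).exists_max_image t (Finset.card_pos.1 (by omega))
    have hcard' := Finset.card_erase_of_mem hb
    obtain ⟨w, hw, hsum⟩ := ih ((W.erase a).erase b) (by omega)
    have hwa := Finset.mem_of_mem_erase hw
    have hwW := Finset.mem_of_mem_erase hwa
    refine ⟨w, hwW, fun g hg => ?_⟩
    have h₁ := Finset.add_sum_erase W g ha
    have h₂ := Finset.add_sum_erase (W.erase a) g hb
    have h₃ := hg a b (hamin w hwW) (hbmax w hwa)
    have h₄ := hsum g hg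
    linarith

/-- If a unit vector `w` lies in the cone spanned by unit vectors `a` and `b`, then a norming
functional of `w` is nonnegative at `a + b`. -/
theorem add_apply_nonneg_of_norming {E : Type*} [NormedAddCommGroup E] [NormedSpace ℝ E]
    (f : E →L[ℝ] ℝ) (hf : ‖f‖ ≤ 1) {a b w : E} (ha : ‖a‖ = 1) (hb : ‖b‖ = 1) (hw : ‖w‖ = 1)
    (hfw : f w = 1) {α β : ℝ} (hα : 0 ≤ α) (hβ : 0 ≤ β) (h : w = α • a + β • b) :
    0 ≤ f a + f b := by
  wlog hab : f a ≤ f b generalizing a b α β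
  · rw [add_comm (f a)]
    exact this hb ha hβ hα (by rw [h, add_comm]) (le_of_not_ge hab)
  have hfab : α * f a + β * f b = 1 := by
    rw [← hfw, h]; simp
  have hfa : -1 ≤ f a := by
    have := f.le_of_opNorm_le hf a
    rw [ha, Real.norm_eq_abs] at this
    linarith [neg_le_of_abs_le this]
  have hβα : β ≤ 1 + α := by
    have h₁ : β • b = w - α • a := by rw [h]; abel
    have h₂ := norm_sub_le w (α • a)
    rw [← h₁, norm_smul, norm_smul, ha, hb, hw, Real.norm_of_nonneg hα,
      Real.norm_of_nonneg hβ] at h₂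
    linarith
  by_contra! hneg
  have hfa₀ : f a < 0 := by linarith
  nlinarith [mul_nonneg hβ (by linarith : 0 ≤ -f a - f b),
    mul_nonneg (sub_nonneg.2 hβα) (neg_nonneg.2 hfa₀.le)]

/-- Unit vectors in an open half-plane of a normed plane: every odd subsum has norm at least 1. -/
theorem one_le_norm_sum_of_odd_card_of_pos {E : Type*} [NormedAddCommGroup E] [NormedSpace ℝ E]
    (hdim : Module.finrank ℝ E = 2) (l : E →ₗ[ℝ] ℝ) {ι : Type*} (u : ι → E)
    (hu : ∀ i, ‖u i‖ = 1) (hl : ∀ i, 0 < l (u i)) (W : Finset ι) (hW : Odd W.card) :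
    1 ≤ ‖∑ i ∈ W, u i‖ := by
  classical
  have : FiniteDimensional ℝ E := Module.finite_of_finrank_eq_succ hdim
  obtain ⟨i₀, -⟩ := Finset.card_pos.1 hW.pos
  have hl₀ : l ≠ 0 := by
    rintro rfl
    simpa using hl i₀
  have hker : Module.finrank ℝ (LinearMap.ker l) = 1 := by
    have := Module.Dual.finrank_ker_add_one_of_ne_zero hl₀
    omega
  obtain ⟨e, -, he⟩ := finrank_eq_one_iff'.1 hker
  have hex : ∀ i, ∃ t : ℝ, (l (u i))⁻¹ • u i = (l (u i₀))⁻¹ • u i₀ + t • (e : E) := by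
    intro i
    obtain ⟨t, ht⟩ := he ⟨(l (u i))⁻¹ • u i - (l (u i₀))⁻¹ • u i₀, by
      simp [(hl i).ne', (hl i₀).ne']⟩
    refine ⟨t, ?_⟩
    have ht' : t • (e : E) = _ := congrArg Subtype.val ht
    rw [ht', add_sub_cancel]
  choose t ht using hex
  obtain ⟨w, -, hsum⟩ := W.exists_median_le_sum t hW
  obtain ⟨f, hf, hfw⟩ := exists_dual_vector'' ℝ (u w)
  have hfw' : f (u w) = 1 := by simpa [hu w] using hfw
  have key := hsum (fun i => f (u i)) fun a b hab hwb => by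
    have hseg : t w ∈ segment ℝ (t a) (t b) := by
      rw [segment_eq_Icc (hab.trans hwb)]
      exact ⟨hab, hwb⟩
    obtain ⟨r, s, hr, hs, hrs, hrst⟩ := hseg
    have hcomb : (l (u w))⁻¹ • u w = r • (l (u a))⁻¹ • u a + s • (l (u b))⁻¹ • u b := by
      rw [ht w, ht a, ht b, ← hrst]
      simp only [smul_eq_mul]
      obtain rfl : s = 1 - r := by linarith
      module
    refine add_apply_nonneg_of_norming f hf (hu a) (hu b) (hu w) hfw'
      (α := l (u w) * r * (l (u a))⁻¹) (β := l (u w) * s * (l (u b))⁻¹) ?_ ?_ ?_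
    · exact mul_nonneg (mul_nonneg (hl w).le hr) (inv_nonneg.2 (hl a).le)
    · exact mul_nonneg (mul_nonneg (hl w).le hs) (inv_nonneg.2 (hl b).le)
    · have := congrArg (l (u w) • ·) hcomb
      simpa only [smul_inv_smul₀ (hl w).ne', smul_add, smul_smul, mul_assoc] using this
  calc 1 ≤ f (∑ i ∈ W, u i) := by rw [map_sum, ← hfw']; exact key
    _ ≤ ‖f (∑ i ∈ W, u i)‖ := Real.le_norm_self _
    _ ≤ 1 * ‖∑ i ∈ W, u i‖ := f.le_of_opNorm_le hf _
    _ = _ := one_mul _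

/-- Remark 3: for unit vectors `v 1, …, v n` in a normed plane one can choose signs
`ε i ∈ {1, -1}` so that every odd-size signed subsum has norm at least 1. -/
theorem exists_signs_odd_subsum_norm_ge_one
    {E : Type*} [NormedAddCommGroup E] [NormedSpace ℝ E]
    (hdim : Module.finrank ℝ E = 2)
    {n : ℕ} (v : Fin n → E) (hv : ∀ i, ‖v i‖ = 1) :
    ∃ ε : Fin n → ℝ, (∀ i, ε i = 1 ∨ ε i = -1) ∧
      ∀ W : Finset (Fin n), Odd W.card → 1 ≤ ‖∑ i ∈ W, ε i • v i‖ := by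
  have hv₀ : ∀ i, v i ≠ 0 := fun i h0 => by simpa [h0] using hv i
  obtain ⟨l, hl⟩ := Module.exists_dual_forall_apply_ne_zero (K := ℝ) v hv₀
  let ε : Fin n → ℝ := fun i => if 0 < l (v i) then 1 else -1
  have hε : ∀ i, ε i = 1 ∨ ε i = -1 := fun i => ite_eq_or_eq _ _ _
  refine ⟨ε, hε, one_le_norm_sum_of_odd_card_of_pos hdim l (fun i => ε i • v i) ?_ ?_⟩
  · intro i
    rcases hε i with h | h <;> simp [h, hv i]
  · intro i
    by_cases h : 0 < l (v i)
    · simp [ε, h]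
    · simpa [ε, h] using lt_of_le_of_ne (not_lt.1 h) (hl i)
end

section
/- Let K be a convex body in the Euclidean plane with 0 in the interior of K. Suppose that for any three pairwise distinct vectors a, b, c on the boundary of K that are contained in a closed halfplane whose bounding line goes through 0 (that is, there exists a nonzero vector u with u·a ≥ 0, u·b ≥ 0 and u·c ≥ 0), the vector a + b + c is not in the interior of K. Then K is centrally symmetric with center 0, i.e. x ∈ K if and only if -x ∈ K. -/
open scoped RealInnerProductSpace

/-- Every nonzero vector of the Euclidean plane has a nonzero orthogonal vector. -/
lemma exists_ne_zero_inner_eq_zero (x : EuclideanSpace ℝ (Fin 2)) (hx : x ≠ 0) :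
    ∃ u : EuclideanSpace ℝ (Fin 2), u ≠ 0 ∧ ⟪u, x⟫ = 0 := by
  refine ⟨!₂[-x 1, x 0], fun h => hx ?_, ?_⟩
  · have h0 := congrArg (fun v : EuclideanSpace ℝ (Fin 2) => v 0) h
    have h1 := congrArg (fun v : EuclideanSpace ℝ (Fin 2) => v 1) h
    ext i
    fin_cases i <;> simp_all
  · simp [PiLp.inner_apply, Fin.sum_univ_two]
    ring

/-- Under the halfplane condition, the gauge of `-x` is at most the gauge of `x`. -/
lemma gauge_neg_le_of_halfplane_condition
    (K : Set (EuclideanSpace ℝ (Fin 2)))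
    (hKcomp : IsCompact K) (hKconv : Convex ℝ K) (h0 : (0 : EuclideanSpace ℝ (Fin 2)) ∈ interior K)
    (hcond : ∀ a b c : EuclideanSpace ℝ (Fin 2),
      a ∈ frontier K → b ∈ frontier K → c ∈ frontier K →
      a ≠ b → a ≠ c → b ≠ c →
      (∃ u : EuclideanSpace ℝ (Fin 2), u ≠ 0 ∧ 0 ≤ ⟪u, a⟫ ∧ 0 ≤ ⟪u, b⟫ ∧ 0 ≤ ⟪u, c⟫) →
      a + b + c ∉ interior K)
    (x : EuclideanSpace ℝ (Fin 2)) (hx : x ≠ 0) : gauge K (-x) ≤ gauge K x := by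
  by_contra! hlt
  have hnhds : K ∈ nhds 0 := mem_interior_iff_mem_nhds.1 h0
  have hpos : ∀ y, y ≠ 0 → 0 < gauge K y := fun y hy =>
    (gauge_pos (absorbent_nhds_zero hnhds)
      ((NormedSpace.isVonNBounded_iff ℝ).2 hKcomp.isBounded)).2 hy
  have hcont : Continuous (gauge K) := continuous_gauge hKconv hnhds
  have hfront : ∀ y, y ≠ 0 → (gauge K y)⁻¹ • y ∈ frontier K := fun y hy => by
    rw [← gauge_eq_one_iff_mem_frontier hKconv hnhds,
      gauge_smul_of_nonneg (inv_nonneg.2 (hpos y hy).le), smul_eq_mul,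
      inv_mul_cancel₀ (hpos y hy).ne']
  obtain ⟨u, hu, hux⟩ := exists_ne_zero_inner_eq_zero x hx
  have hA := hpos x hx
  have hB := hpos (-x) (neg_ne_zero.2 hx)
  have hbase : (gauge K x)⁻¹ • x + (gauge K (-x))⁻¹ • (-x) + (gauge K (-x))⁻¹ • (-x)
      ∈ interior K := by
    rw [← gauge_lt_one_iff_mem_interior hKconv hnhds]
    have hβ : (gauge K (-x))⁻¹ < (gauge K x)⁻¹ := inv_strictAnti₀ hA hlt
    have hβ0 : 0 < (gauge K (-x))⁻¹ := inv_pos.2 hB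
    rcases le_total 0 ((gauge K x)⁻¹ - 2 * (gauge K (-x))⁻¹) with h | h
    · rw [show (gauge K x)⁻¹ • x + (gauge K (-x))⁻¹ • (-x) + (gauge K (-x))⁻¹ • (-x)
        = ((gauge K x)⁻¹ - 2 * (gauge K (-x))⁻¹) • x by module,
        gauge_smul_of_nonneg h, smul_eq_mul, sub_mul, inv_mul_cancel₀ hA.ne']
      have := mul_pos hβ0 hA
      linarith
    · rw [show (gauge K x)⁻¹ • x + (gauge K (-x))⁻¹ • (-x) + (gauge K (-x))⁻¹ • (-x)
        = (2 * (gauge K (-x))⁻¹ - (gauge K x)⁻¹) • (-x) by module,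
        gauge_smul_of_nonneg (by linarith), smul_eq_mul, sub_mul, mul_assoc,
        inv_mul_cancel₀ hB.ne']
      have : (gauge K (-x))⁻¹ * gauge K (-x) < (gauge K x)⁻¹ * gauge K (-x) := by gcongr
      rw [inv_mul_cancel₀ hB.ne'] at this
      linarith
  let f : ℝ → EuclideanSpace ℝ (Fin 2) := fun t =>
    (gauge K x)⁻¹ • x + (gauge K (-x))⁻¹ • (-x) + (gauge K (-x + t • u))⁻¹ • (-x + t • u)
  have hf : ContinuousAt f 0 := by
    have hline : ContinuousAt (fun t : ℝ => -x + t • u) 0 := by fun_prop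
    have hg : ContinuousAt (fun t : ℝ => gauge K (-x + t • u)) 0 := hcont.continuousAt.comp hline
    have hg0 : gauge K (-x + (0 : ℝ) • u) ≠ 0 := by simpa using hB.ne'
    exact continuousAt_const.add ((hg.inv₀ hg0).smul hline)
  have hev : ∀ᶠ t in nhds (0 : ℝ), f t ∈ interior K :=
    hf.eventually_mem (isOpen_interior.mem_nhds (by simpa [f] using hbase))
  obtain ⟨t, htK, ht⟩ :=
    ((hev.filter_mono nhdsWithin_le_nhds).and (self_mem_nhdsWithin (s := Set.Ioi (0 : ℝ)))).exists
  have ht : 0 < t := ht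
  have huu : 0 < ⟪u, u⟫ := real_inner_self_pos.2 hu
  have hinner : ⟪u, -x + t • u⟫ = t * ⟪u, u⟫ := by
    simp only [inner_add_right, inner_neg_right, inner_smul_right, hux, neg_zero, zero_add]
  have hy : -x + t • u ≠ 0 := fun h => by
    rw [h, inner_zero_right] at hinner
    exact (mul_pos ht huu).ne hinner
  have hc : 0 < ⟪u, (gauge K (-x + t • u))⁻¹ • (-x + t • u)⟫ := by
    rw [inner_smul_right, hinner]
    exact mul_pos (inv_pos.2 (hpos _ hy)) (mul_pos ht huu)
  have ha : ⟪u, (gauge K x)⁻¹ • x⟫ = 0 := by rw [inner_smul_right, hux, mul_zero]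
  have hb : ⟪u, (gauge K (-x))⁻¹ • (-x)⟫ = 0 := by
    rw [inner_smul_right, inner_neg_right, hux, neg_zero, mul_zero]
  refine hcond _ _ _ (hfront x hx) (hfront (-x) (neg_ne_zero.2 hx)) (hfront _ hy) ?_ ?_ ?_
    ⟨u, hu, ha.ge, hb.ge, hc.le⟩ htK
  · intro h
    have h' : ((gauge K x)⁻¹ + (gauge K (-x))⁻¹) • x = 0 := by
      rw [add_smul, h, smul_neg, neg_add_cancel]
    exact (smul_ne_zero (add_pos (inv_pos.2 hA) (inv_pos.2 hB)).ne' hx) h'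
  · intro h
    exact hc.ne' (h ▸ ha)
  · intro h
    exact hc.ne' (h ▸ hb)

/-- Theorem 4(i): a planar convex body `K` with `0` in its interior is centrally
symmetric about `0` provided that for any three distinct boundary points lying in a
closed halfplane bounded by a line through `0`, their sum is not in the interior
of `K`. -/
theorem centrally_symmetric_of_halfplane_condition
    (K : Set (EuclideanSpace ℝ (Fin 2)))
    (hKcomp : IsCompact K) (hKconv : Convex ℝ K) (h0 : (0 : EuclideanSpace ℝ (Fin 2)) ∈ interior K)
    (hcond : ∀ a b c : EuclideanSpace ℝ (Fin 2),
      a ∈ frontier K → b ∈ frontier K → c ∈ frontier K →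
      a ≠ b → a ≠ c → b ≠ c →
      (∃ u : EuclideanSpace ℝ (Fin 2), u ≠ 0 ∧ 0 ≤ ⟪u, a⟫ ∧ 0 ≤ ⟪u, b⟫ ∧ 0 ≤ ⟪u, c⟫) →
      a + b + c ∉ interior K) :
    ∀ x, x ∈ K ↔ -x ∈ K := by
  have hnhds : K ∈ nhds 0 := mem_interior_iff_mem_nhds.1 h0
  have hmem : ∀ y, y ∈ K ↔ gauge K y ≤ 1 := fun y => by
    rw [gauge_le_one_iff_mem_closure hKconv hnhds, hKcomp.isClosed.closure_eq]
  intro x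
  rcases eq_or_ne x 0 with rfl | hx
  · rw [neg_zero]
  have h1 := gauge_neg_le_of_halfplane_condition K hKcomp hKconv h0 hcond x hx
  have h2 := gauge_neg_le_of_halfplane_condition K hKcomp hKconv h0 hcond (-x) (neg_ne_zero.2 hx)
  rw [neg_neg] at h2
  rw [hmem, hmem, le_antisymm h1 h2]
end

section
/- Let K be a convex body in the Euclidean plane with 0 in the interior of K. Suppose that for any three pairwise distinct vectors a, b, c on the boundary of K with 0 in the interior of the convex hull of {a, b, c}, the vector a + b + c lies in the interior of K. Then K is centrally symmetric with center 0, i.e. x ∈ K if and only if -x ∈ K. -/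
open Set Filter Topology

/-- A ray starting in a compact set leaves it for good at a frontier point. -/
lemma IsCompact.exists_last_frontier_point_on_ray {E : Type*} [NormedAddCommGroup E]
    [NormedSpace ℝ E] {K : Set E} (hK : IsCompact K) {p v : E} (hp : p ∈ K) (hv : v ≠ 0) :
    ∃ r : ℝ, 0 ≤ r ∧ p + r • v ∈ frontier K ∧ ∀ s, r < s → p + s • v ∉ K := by
  set S : Set ℝ := {r | p + r • v ∈ K} with hS
  have hcont : Continuous fun r : ℝ => p + r • v := by fun_prop
  have hSclosed : IsClosed S := hK.isClosed.preimage hcont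
  have hSbdd : Bornology.IsBounded S := by
    obtain ⟨C, hC⟩ := hK.isBounded.exists_norm_le
    refine isBounded_iff_forall_norm_le.2 ⟨(C + ‖p‖) / ‖v‖, fun r hr => ?_⟩
    rw [le_div_iff₀ (norm_pos_iff.2 hv), ← norm_smul]
    calc ‖r • v‖ = ‖(p + r • v) - p‖ := by rw [add_sub_cancel_left]
      _ ≤ ‖p + r • v‖ + ‖p‖ := norm_sub_le _ _
      _ ≤ C + ‖p‖ := by gcongr; exact hC _ hr
  have h0S : (0 : ℝ) ∈ S := by simpa [hS] using hp
  obtain ⟨r, hrS, hr⟩ :=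
    (Metric.isCompact_of_isClosed_isBounded hSclosed hSbdd).exists_isGreatest ⟨0, h0S⟩
  refine ⟨r, hr h0S, ⟨subset_closure hrS, fun hint => ?_⟩, fun s hs hsK => (hr hsK).not_gt hs⟩
  have hev : ∀ᶠ s in 𝓝 r, p + s • v ∈ K :=
    hcont.continuousAt.eventually (mem_interior_iff_mem_nhds.1 hint)
  obtain ⟨s, hsK, hs⟩ :=
    ((hev.filter_mono nhdsWithin_le_nhds).and (self_mem_nhdsWithin : Ioi r ∈ 𝓝[>] r)).exists
  exact (hr hsK).not_gt hs

/-- Three plane vectors with a vanishing positive combination, two of which are linearly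
independent, are the vertices of a triangle around the origin. -/
lemma zero_mem_interior_convexHull_of_pos_combination {a b c : EuclideanSpace ℝ (Fin 2)}
    (hD : a 0 * c 1 - a 1 * c 0 ≠ 0) {α β γ : ℝ} (hα : 0 < α) (hβ : 0 < β) (hγ : 0 < γ)
    (h : α • a + β • b + γ • c = 0) :
    (0 : EuclideanSpace ℝ (Fin 2)) ∈ interior (convexHull ℝ {a, b, c}) := by
  set D := a 0 * c 1 - a 1 * c 0 with hDdef
  set σ := α + β + γ with hσ
  have hσ0 : 0 < σ := by positivity
  let s : EuclideanSpace ℝ (Fin 2) → ℝ := fun v => (v 0 * c 1 - v 1 * c 0) / D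
  let t : EuclideanSpace ℝ (Fin 2) → ℝ := fun v => (a 0 * v 1 - a 1 * v 0) / D
  have hst : ∀ v, s v • a + t v • c = v := by
    intro v
    ext i
    fin_cases i <;> simp [s, t] <;> field_simp <;> simp only [hDdef] <;> ring
  have hs : Continuous s := by fun_prop
  have ht : Continuous t := by fun_prop
  have hs0 : s 0 = 0 := by simp [s]
  have ht0 : t 0 = 0 := by simp [t]
  have pos : ∀ f : EuclideanSpace ℝ (Fin 2) → ℝ, Continuous f → 0 < f 0 → ∀ᶠ v in 𝓝 0, 0 < f v :=
    fun f hf h0 => hf.continuousAt.eventually (lt_mem_nhds h0)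
  rw [mem_interior_iff_mem_nhds]
  filter_upwards [pos (fun v => s v + (1 - s v - t v) * (α / σ)) (by fun_prop)
      (by simp only [hs0, ht0]; norm_num; positivity),
    pos (fun v => (1 - s v - t v) * (β / σ)) (by fun_prop)
      (by simp only [hs0, ht0]; norm_num; positivity),
    pos (fun v => t v + (1 - s v - t v) * (γ / σ)) (by fun_prop)
      (by simp only [hs0, ht0]; norm_num; positivity)] with v h1 h2 h3
  have hv : (s v + (1 - s v - t v) * (α / σ)) • a + ((1 - s v - t v) * (β / σ)) • b
      + (t v + (1 - s v - t v) * (γ / σ)) • c = v := by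
    calc _ = (s v • a + t v • c) + ((1 - s v - t v) / σ) • (α • a + β • b + γ • c) := by module
      _ = v := by rw [h, smul_zero, add_zero, hst]
  have hsum : (s v + (1 - s v - t v) * (α / σ)) + ((1 - s v - t v) * (β / σ))
      + (t v + (1 - s v - t v) * (γ / σ)) = 1 := by
    field_simp
    rw [hσ]
    ring
  have hmem := (convex_convexHull ℝ ({a, b, c} : Set (EuclideanSpace ℝ (Fin 2)))).sum_mem
    (t := Finset.univ)
    (w := ![s v + (1 - s v - t v) * (α / σ), (1 - s v - t v) * (β / σ),
      t v + (1 - s v - t v) * (γ / σ)]) (z := ![a, b, c])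
    (by simpa [Fin.forall_fin_succ] using ⟨h1.le, h2.le, h3.le⟩)
    (by simpa [Fin.sum_univ_three] using hsum)
    (fun i _ => subset_convexHull ℝ _ (by fin_cases i <;> simp))
  rw [Fin.sum_univ_three] at hmem
  rw [← hv]
  exact hmem

/-- Theorem 4(ii): a planar convex body `K` with `0` in its interior is centrally
symmetric about `0` provided that for any three distinct boundary points whose convex
hull contains `0` in its interior, their sum lies in the interior of `K`. -/
theorem centrally_symmetric_of_triangle_condition
    (K : Set (EuclideanSpace ℝ (Fin 2)))
    (hKcomp : IsCompact K) (hKconv : Convex ℝ K) (h0 : (0 : EuclideanSpace ℝ (Fin 2)) ∈ interior K)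
    (hcond : ∀ a b c : EuclideanSpace ℝ (Fin 2),
      a ∈ frontier K → b ∈ frontier K → c ∈ frontier K →
      a ≠ b → a ≠ c → b ≠ c →
      (0 : EuclideanSpace ℝ (Fin 2)) ∈ interior (convexHull ℝ {a, b, c}) →
      a + b + c ∈ interior K) :
    ∀ x, x ∈ K ↔ -x ∈ K := by
  suffices key : ∀ x ∈ K, -x ∈ K from fun x => ⟨key x, fun h => neg_neg x ▸ key _ h⟩
  by_contra! hne
  obtain ⟨x, hxK, hnx⟩ := hne
  have hx : x ≠ 0 := by
    rintro rfl
    exact hnx (by simpa using hxK)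
  have h0K : (0 : EuclideanSpace ℝ (Fin 2)) ∈ K := interior_subset h0
  have hK0 : K ∈ 𝓝 (0 : EuclideanSpace ℝ (Fin 2)) := mem_interior_iff_mem_nhds.1 h0
  have hfr : ∀ {y}, y ∈ frontier K ↔ gauge K y = 1 := fun {y} =>
    (gauge_eq_one_iff_mem_frontier hKconv hK0).symm
  obtain ⟨r, -, har, hr⟩ := hKcomp.exists_last_frontier_point_on_ray h0K hx
  obtain ⟨m, hm0, hbm, -⟩ := hKcomp.exists_last_frontier_point_on_ray h0K (neg_ne_zero.2 hx)
  simp only [zero_add] at har hr hbm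
  have hr1 : 1 ≤ r := by
    by_contra! h
    exact hr 1 h (by simpa using hxK)
  have hm : 0 < m := by
    refine hm0.lt_of_ne ?_
    rintro rfl
    rw [zero_smul] at hbm
    exact hbm.2 h0
  have hm1 : m < 1 := by
    by_contra! h
    refine hnx ?_
    have := hKconv.smul_mem_of_zero_mem h0K (hKcomp.isClosed.frontier_subset hbm)
      (t := m⁻¹) ⟨by positivity, inv_le_one_of_one_le₀ h⟩
    rwa [smul_smul, inv_mul_cancel₀ hm.ne', one_smul] at this
  set u : EuclideanSpace ℝ (Fin 2) := !₂[-x 1, x 0] with hu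
  obtain ⟨s, hsK, hs⟩ : ∃ s : ℝ, s • u ∈ K ∧ 0 < s := by
    have hcont : Continuous fun s : ℝ => s • u := by fun_prop
    have hev : ∀ᶠ s : ℝ in 𝓝 0, s • u ∈ K :=
      hcont.continuousAt.eventually (by simpa using hK0)
    exact ((hev.filter_mono nhdsWithin_le_nhds).and
      (self_mem_nhdsWithin : Ioi (0 : ℝ) ∈ 𝓝[>] 0)).exists
  obtain ⟨ρ, -, hcK, hρ⟩ := hKcomp.exists_last_frontier_point_on_ray hsK hx
  set a := r • x with ha
  set b := m • -x with hb
  set c := s • u + ρ • x with hc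
  have hr0 : 0 < r := by linarith
  have hxx : 0 < x 0 ^ 2 + x 1 ^ 2 := by
    have h := EuclideanSpace.norm_sq_eq x
    simp only [Fin.sum_univ_two, Real.norm_eq_abs, sq_abs] at h
    rw [← h]
    positivity
  have hD : a 0 * c 1 - a 1 * c 0 ≠ 0 := by
    have : a 0 * c 1 - a 1 * c 0 = r * s * (x 0 ^ 2 + x 1 ^ 2) := by
      simp [ha, hc, hu]
      ring
    rw [this]
    positivity
  -- frontier points `B ε` close to `b` such that `a`, `B ε`, `c` surround the origin
  let B : ℝ → EuclideanSpace ℝ (Fin 2) := fun ε => (gauge K (b - ε • c))⁻¹ • (b - ε • c)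
  have hgcont : Continuous fun ε : ℝ => gauge K (b - ε • c) :=
    (continuous_gauge hKconv hK0).comp (by fun_prop)
  have hg0 : gauge K (b - (0 : ℝ) • c) = 1 := by simpa using hfr.1 hbm
  have hB0 : B 0 = b := by simp only [B, hg0]; simp
  have hBcont : ContinuousAt B 0 :=
    (hgcont.continuousAt.inv₀ (by rw [hg0]; exact one_ne_zero)).smul (by fun_prop)
  have hgpos : ∀ᶠ ε in 𝓝 (0 : ℝ), 0 < gauge K (b - ε • c) :=
    hgcont.continuousAt.eventually (lt_mem_nhds (one_pos.trans_eq hg0.symm))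
  have hsumK : ∀ᶠ ε in 𝓝[>] (0 : ℝ), a + B ε + c ∈ K := by
    filter_upwards [hgpos.filter_mono nhdsWithin_le_nhds, self_mem_nhdsWithin] with ε hg hε
    have hε : 0 < ε := hε
    have hBf : B ε ∈ frontier K := by
      rw [hfr, gauge_smul_of_nonneg (by positivity), smul_eq_mul, inv_mul_cancel₀ hg.ne']
    have hcomb : (m / r) • a + gauge K (b - ε • c) • B ε + ε • c = 0 := by
      simp only [B]
      rw [smul_inv_smul₀ hg.ne', ha, smul_smul, div_mul_cancel₀ _ hr0.ne', hb]
      module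
    have hmr : 0 < m / r := by positivity
    have e0 := congrArg (fun v : EuclideanSpace ℝ (Fin 2) => v 0) hcomb
    have e1 := congrArg (fun v : EuclideanSpace ℝ (Fin 2) => v 1) hcomb
    simp only [PiLp.add_apply, PiLp.smul_apply, smul_eq_mul, PiLp.zero_apply] at e0 e1
    refine interior_subset (hcond a (B ε) c har hBf hcK ?_ ?_ ?_
      (zero_mem_interior_convexHull_of_pos_combination hD hmr hg hε hcomb))
    · intro h
      rw [← h] at e0 e1
      refine mul_ne_zero (add_pos hmr hg).ne' hD ?_
      linear_combination c 1 * e0 - c 0 * e1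
    · intro h
      rw [← h] at hD
      exact hD (by ring)
    · intro h
      rw [h] at e0 e1
      refine mul_ne_zero (add_pos hg hε).ne' hD ?_
      linear_combination a 0 * e1 - a 1 * e0
  have hlim : Tendsto (fun ε => a + B ε + c) (𝓝[>] 0) (𝓝 (a + b + c)) := by
    have := (hBcont.tendsto.mono_left nhdsWithin_le_nhds : Tendsto B (𝓝[>] 0) _)
    rw [hB0] at this
    exact (this.const_add a).add_const c
  have habc : a + b + c ∈ K := hKcomp.isClosed.mem_of_tendsto hlim hsumK
  refine hρ (ρ + (r - m)) (by linarith) ?_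
  convert habc using 1
  simp only [ha, hb, hc]
  module
end

section
/- There exist four unit vectors v_1, v_2, v_3, v_4 in Euclidean 3-space (the vertices of a regular tetrahedron inscribed in the unit sphere, centered at the origin) such that v_1 + v_2 + v_3 + v_4 = 0 and every 3-sum v_i + v_j + v_k over pairwise distinct indices has Euclidean norm exactly 1. Hence the Helly-type theorem for sums of unit vectors has no direct analogue in ℝ³. -/
/-- If four vectors sum to zero, every sum of three of them is the negative of the fourth. -/
theorem exists_add_add_eq_neg_of_sum_eq_zero {E : Type*} [AddCommGroup E] {v : Fin 4 → E}
    (hv : ∑ i, v i = 0) {i j k : Fin 4} (hij : i ≠ j) (hik : i ≠ k) (hjk : j ≠ k) :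
    ∃ l, v i + v j + v k = -v l := by
  obtain ⟨l, hl⟩ : ∃ l : Fin 4, (Finset.univ : Finset (Fin 4)) = {i, j, k, l} ∧
      i ≠ l ∧ j ≠ l ∧ k ≠ l := by
    decide +revert
  refine ⟨l, eq_neg_of_add_eq_zero_left ?_⟩
  obtain ⟨huniv, hil, hjl, hkl⟩ := hl
  rw [huniv, Finset.sum_insert (by simp [*]), Finset.sum_insert (by simp [*]),
    Finset.sum_insert (by simp [*]), Finset.sum_singleton] at hv
  simpa only [add_assoc] using hv

/-- The vertices of a regular tetrahedron inscribed in the unit sphere. -/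
noncomputable def tetrahedronVertex (i : Fin 4) : EuclideanSpace ℝ (Fin 3) :=
  (√3)⁻¹ • ![!₂[1, 1, 1], !₂[1, -1, -1], !₂[-1, 1, -1], !₂[-1, -1, 1]] i

theorem norm_tetrahedronVertex (i : Fin 4) : ‖tetrahedronVertex i‖ = 1 := by
  have h : (1 + 1 + 1 : ℝ) = 3 := by norm_num
  fin_cases i <;>
    simp [tetrahedronVertex, norm_smul, EuclideanSpace.norm_eq, Fin.sum_univ_three, h,
      abs_of_nonneg (Real.sqrt_nonneg 3)]

theorem sum_tetrahedronVertex : ∑ i, tetrahedronVertex i = 0 := by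
  ext j
  fin_cases j <;> simp [tetrahedronVertex, Fin.sum_univ_four]

/-- Remark 4: four unit vectors in Euclidean 3-space (vertices of a regular
tetrahedron) summing to zero, all of whose 3-sums over distinct indices have norm
exactly 1. -/
theorem exists_tetrahedron_counterexample :
    ∃ v : Fin 4 → EuclideanSpace ℝ (Fin 3), (∀ i, ‖v i‖ = 1) ∧
      (∑ i, v i = 0) ∧
      (∀ i j k : Fin 4, i ≠ j → i ≠ k → j ≠ k → ‖v i + v j + v k‖ = 1) := by
  refine ⟨tetrahedronVertex, norm_tetrahedronVertex, sum_tetrahedronVertex, ?_⟩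
  intro i j k hij hik hjk
  obtain ⟨l, hl⟩ := exists_add_add_eq_neg_of_sum_eq_zero sum_tetrahedronVertex hij hik hjk
  rw [hl, norm_neg, norm_tetrahedronVertex]
end
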